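/- arXiv:1401.5667 — 8 statements merged into one kernel-verified Lean document; each statement's English description precedes it below -/
import Mathlib

section
/- Let H be a real Hilbert space, A : H → H a bounded linear operator, and τ, T > 0. Let u : [-τ, T] → H be continuous, continuously differentiable on [-τ, 0] and twice continuously differentiable on [0, T] (one-sided at the endpoints), and let f : [0, T] → H be continuous, such that u''(t) = A(u(t - τ)) + f(t) for all t ∈ [0, T]. Then there exists a constant C > 0, depending only on ‖A‖, τ and T, such that max_{t ∈ [0,T]} (‖u(t)‖² + ‖u'(t)‖²) ≤ C (‖u(0)‖² + ‖u'(0⁺)‖² + ∫_{-τ}^{0} (‖u(s)‖² + ‖u'(s)‖²) ds + ∫_{0}^{T} ‖f(s)‖² ds), where u'(0⁺) denotes the right derivative of u at 0. -/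
open Real Set Filter Topology MeasureTheory

/-- A continuous function on `[a, b]` has a primitive on `[a, b]` that is differentiable on `ℝ`. -/
theorem exists_primitive_of_continuousOn_Icc {a b : ℝ} (hab : a ≤ b) {g : ℝ → ℝ}
    (hg : ContinuousOn g (Set.Icc a b)) :
    ∃ P : ℝ → ℝ, Differentiable ℝ P ∧ (∀ t ∈ Set.Icc a b, HasDerivAt P (g t) t) ∧
      ∀ x ∈ Set.Icc a b, ∀ y ∈ Set.Icc a b, ∫ s in x..y, g s = P y - P x := by
  set G : ℝ → ℝ := Set.IccExtend hab ((Set.Icc a b).domRestrict g) with hG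
  have hGc : Continuous G := (continuousOn_iff_continuous_domRestrict.1 hg).Icc_extend'
  have hGg : ∀ t ∈ Set.Icc a b, G t = g t := fun t ht => by
    rw [hG, Set.IccExtend_of_mem hab _ ht, Set.domRestrict_apply]
  have hd : ∀ t, HasDerivAt (fun t => ∫ s in a..t, G s) (G t) t := fun t =>
    intervalIntegral.integral_hasDerivAt_right (hGc.intervalIntegrable _ _)
      (hGc.stronglyMeasurableAtFilter _ _) hGc.continuousAt
  refine ⟨fun t => ∫ s in a..t, G s, fun t => (hd t).differentiableAt,
    fun t ht => hGg t ht ▸ hd t, fun x hx y hy => ?_⟩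
  rw [intervalIntegral.integral_interval_sub_left (hGc.intervalIntegrable _ _)
    (hGc.intervalIntegrable _ _)]
  exact intervalIntegral.integral_congr fun s hs => (hGg s (Set.uIcc_subset_Icc hx hy hs)).symm

/-- Differential form of Grönwall's inequality: if `g' ≤ K g` on `(0, T)`, then
`g t ≤ exp (K t) g 0` on `[0, T]`. -/
theorem le_exp_mul_of_hasDerivAt_le {T K : ℝ} {g g' : ℝ → ℝ}
    (hg : ContinuousOn g (Set.Icc 0 T))
    (hd : ∀ t ∈ Set.Ioo (0 : ℝ) T, HasDerivAt g (g' t) t)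
    (hle : ∀ t ∈ Set.Ioo (0 : ℝ) T, g' t ≤ K * g t) {t : ℝ} (ht : t ∈ Set.Icc (0 : ℝ) T) :
    g t ≤ Real.exp (K * t) * g 0 := by
  have hanti : AntitoneOn (fun t => Real.exp (-(K * t)) * g t) (Set.Icc 0 T) := by
    have hder : ∀ s ∈ Set.Ioo (0 : ℝ) T, HasDerivAt (fun t => Real.exp (-(K * t)) * g t)
        (Real.exp (-(K * s)) * (g' s - K * g s)) s := fun s hs => by
      have he : HasDerivAt (fun t => Real.exp (-(K * t))) (Real.exp (-(K * s)) * -(K * 1)) s :=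
        ((hasDerivAt_id s).const_mul K).neg.exp
      exact (he.mul (hd s hs)).congr_deriv (by ring)
    refine antitoneOn_of_deriv_nonpos (convex_Icc 0 T)
      (ContinuousOn.mul (by fun_prop) hg) ?_ ?_ <;> rw [interior_Icc] <;> intro s hs
    · exact (hder s hs).differentiableAt.differentiableWithinAt
    · rw [(hder s hs).deriv]
      exact mul_nonpos_of_nonneg_of_nonpos (Real.exp_pos _).le (sub_nonpos.2 (hle s hs))
  have h := hanti (Set.left_mem_Icc.2 (ht.1.trans ht.2)) ht ht.1
  simp only [mul_zero, neg_zero, Real.exp_zero, one_mul] at h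
  calc g t = Real.exp (K * t) * (Real.exp (-(K * t)) * g t) := by
        rw [← mul_assoc, ← Real.exp_add, add_neg_cancel, Real.exp_zero, one_mul]
    _ ≤ _ := by gcongr

/-- **A priori energy estimate** for the abstract second-order evolution equation with pure
delay `u''(t) = A u(t - τ) + f(t)` in a real Hilbert space `H`:
there is a constant `C > 0` depending only on `‖A‖ = r`, `τ` and `T` such that for every
classical solution `u` (continuous on `[-τ, T]`, continuously differentiable on `[-τ, 0]`
with derivative `v`, twice continuously differentiable on `[0, T]` with first derivative `w`
and second derivative `w'`, all one-sided at the endpoints) one has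
`max_{t ∈ [0,T]} (‖u(t)‖² + ‖u'(t)‖²) ≤ C (‖u(0)‖² + ‖u'(0⁺)‖²
  + ∫_{-τ}^0 (‖u‖² + ‖u'‖²) + ∫_0^T ‖f‖²)`, where `u'(0⁺) = w 0`. -/
theorem energy_estimate_delay_wave (τ T r : ℝ) (hτ : 0 < τ) (hT : 0 < T) :
    ∃ C : ℝ, 0 < C ∧
      ∀ (H : Type) [NormedAddCommGroup H] [InnerProductSpace ℝ H] [CompleteSpace H]
        (A : H →L[ℝ] H) (u v w w' f : ℝ → H),
        ‖A‖ = r →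
        ContinuousOn u (Set.Icc (-τ) T) →
        (∀ t ∈ Set.Icc (-τ) (0 : ℝ), HasDerivWithinAt u (v t) (Set.Icc (-τ) 0) t) →
        ContinuousOn v (Set.Icc (-τ) 0) →
        (∀ t ∈ Set.Icc (0 : ℝ) T, HasDerivWithinAt u (w t) (Set.Icc 0 T) t) →
        (∀ t ∈ Set.Icc (0 : ℝ) T, HasDerivWithinAt w (w' t) (Set.Icc 0 T) t) →
        ContinuousOn w' (Set.Icc 0 T) →
        ContinuousOn f (Set.Icc 0 T) →
        (∀ t ∈ Set.Icc (0 : ℝ) T, w' t = A (u (t - τ)) + f t) →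
        ∀ t ∈ Set.Icc (0 : ℝ) T,
          ‖u t‖ ^ 2 + ‖w t‖ ^ 2 ≤
            C * (‖u 0‖ ^ 2 + ‖w 0‖ ^ 2 +
              (∫ s in (-τ)..(0 : ℝ), (‖u s‖ ^ 2 + ‖v s‖ ^ 2)) +
              ∫ s in (0 : ℝ)..T, ‖f s‖ ^ 2) := by
  refine ⟨Real.exp ((3 + r ^ 2) * T) * (1 + r ^ 2), by positivity, ?_⟩
  intro H _ _ _ A u v w w' f hA hu huv hv huw hww _ hf heq t ht
  have hu2 : ContinuousOn (fun s => ‖u s‖ ^ 2) (Set.Icc (-τ) T) := hu.norm.pow 2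
  obtain ⟨P, hPdiff, hPder, hPint⟩ :=
    exists_primitive_of_continuousOn_Icc (by linarith : -τ ≤ T) hu2
  have hf2 : ContinuousOn (fun s => ‖f s‖ ^ 2) (Set.Icc 0 T) := hf.norm.pow 2
  obtain ⟨Q, hQdiff, hQder, hQint⟩ :=
    exists_primitive_of_continuousOn_Icc hT.le hf2
  have huc : ContinuousOn u (Set.Icc 0 T) := fun s hs => (huw s hs).continuousWithinAt
  have hwc : ContinuousOn w (Set.Icc 0 T) := fun s hs => (hww s hs).continuousWithinAt
  -- The energy, augmented by the history term and the remaining forcing.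
  set Φ : ℝ → ℝ := fun s =>
    ‖u s‖ ^ 2 + ‖w s‖ ^ 2 + r ^ 2 * (P s - P (s - τ)) + (Q T - Q s) with hΦ
  have hΦc : ContinuousOn Φ (Set.Icc 0 T) := by
    have hP := hPdiff.continuous
    have hQ := hQdiff.continuous
    exact (((huc.norm.pow 2).add (hwc.norm.pow 2)).add (by fun_prop)).add (by fun_prop)
  have hEΦ : ∀ s ∈ Set.Icc (0 : ℝ) T, ‖u s‖ ^ 2 + ‖w s‖ ^ 2 ≤ Φ s := fun s hs => by
    have h1 : 0 ≤ P s - P (s - τ) := by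
      rw [← hPint _ ⟨by linarith [hs.1], by linarith [hs.2]⟩ _ ⟨by linarith [hs.1], hs.2⟩]
      exact intervalIntegral.integral_nonneg (by linarith) fun _ _ => by positivity
    have h2 : 0 ≤ Q T - Q s := by
      rw [← hQint _ hs _ (Set.right_mem_Icc.2 hT.le)]
      exact intervalIntegral.integral_nonneg hs.2 fun _ _ => by positivity
    have h3 := mul_nonneg (sq_nonneg r) h1
    simp only [hΦ]
    linarith
  have hder : ∀ s ∈ Set.Ioo (0 : ℝ) T, HasDerivAt Φ
      (2 * inner ℝ (u s) (w s) + 2 * inner ℝ (w s) (w' s)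
        + r ^ 2 * (‖u s‖ ^ 2 - ‖u (s - τ)‖ ^ 2) - ‖f s‖ ^ 2) s := fun s hs => by
    have hs' := Set.Ioo_subset_Icc_self hs
    have hnhds := Icc_mem_nhds hs.1 hs.2
    have hdP := hPder s ⟨by linarith [hs.1], hs.2.le⟩
    have hdPτ := (hPder (s - τ) ⟨by linarith [hs.1], by linarith [hs.2]⟩).comp_sub_const s τ
    exact (((((huw s hs').hasDerivAt hnhds).norm_sq.add
      ((hww s hs').hasDerivAt hnhds).norm_sq).add ((hdP.sub hdPτ).const_mul (r ^ 2))).add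
      ((hQder s hs').const_sub (Q T))).congr_deriv (by ring)
  have hle : ∀ s ∈ Set.Ioo (0 : ℝ) T,
      2 * inner ℝ (u s) (w s) + 2 * inner ℝ (w s) (w' s)
        + r ^ 2 * (‖u s‖ ^ 2 - ‖u (s - τ)‖ ^ 2) - ‖f s‖ ^ 2 ≤ (3 + r ^ 2) * Φ s :=
    fun s hs => by
    have hs' := Set.Ioo_subset_Icc_self hs
    have hE := mul_le_mul_of_nonneg_left (hEΦ s hs') (by positivity : 0 ≤ 3 + r ^ 2)
    have young : ∀ x y : H, 2 * inner ℝ x y ≤ ‖x‖ ^ 2 + ‖y‖ ^ 2 := fun x y => by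
      nlinarith [real_inner_le_norm x y, sq_nonneg (‖x‖ - ‖y‖)]
    have hAu : ‖A (u (s - τ))‖ ^ 2 ≤ r ^ 2 * ‖u (s - τ)‖ ^ 2 := by
      rw [← mul_pow, ← hA]
      gcongr
      exact A.le_opNorm _
    rw [heq s hs', inner_add_right]
    nlinarith [young (u s) (w s), young (w s) (A (u (s - τ))), young (w s) (f s),
      mul_nonneg (sq_nonneg r) (sq_nonneg ‖w s‖), sq_nonneg ‖u s‖]
  have hmem0 : (0 : ℝ) ∈ Set.Icc (-τ) T := ⟨by linarith, hT.le⟩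
  have hmemτ : -τ ∈ Set.Icc (-τ) T := ⟨le_rfl, by linarith⟩
  have hint_u : IntervalIntegrable (fun s => ‖u s‖ ^ 2) volume (-τ) 0 :=
    (hu2.mono (Set.Icc_subset_Icc_right hT.le)).intervalIntegrable_of_Icc (by linarith)
  have hint_v : IntervalIntegrable (fun s => ‖v s‖ ^ 2) volume (-τ) 0 :=
    (hv.norm.pow 2).intervalIntegrable_of_Icc (by linarith)
  have hIu : 0 ≤ ∫ s in (-τ)..(0 : ℝ), ‖u s‖ ^ 2 :=
    intervalIntegral.integral_nonneg (by linarith) fun _ _ => by positivity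
  have hIv : 0 ≤ ∫ s in (-τ)..(0 : ℝ), ‖v s‖ ^ 2 :=
    intervalIntegral.integral_nonneg (by linarith) fun _ _ => by positivity
  have hIf : 0 ≤ ∫ s in (0 : ℝ)..T, ‖f s‖ ^ 2 :=
    intervalIntegral.integral_nonneg hT.le fun _ _ => by positivity
  have hΦ0 : Φ 0 = ‖u 0‖ ^ 2 + ‖w 0‖ ^ 2 + r ^ 2 * (∫ s in (-τ)..(0 : ℝ), ‖u s‖ ^ 2)
      + ∫ s in (0 : ℝ)..T, ‖f s‖ ^ 2 := by
    rw [hPint _ hmemτ _ hmem0,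
      hQint _ (Set.left_mem_Icc.2 hT.le) _ (Set.right_mem_Icc.2 hT.le)]
    simp only [hΦ, zero_sub]
  rw [intervalIntegral.integral_add hint_u hint_v, mul_assoc]
  calc ‖u t‖ ^ 2 + ‖w t‖ ^ 2 ≤ Φ t := hEΦ t ht
    _ ≤ Real.exp ((3 + r ^ 2) * t) * Φ 0 := le_exp_mul_of_hasDerivAt_le hΦc hder hle ht
    _ ≤ _ := by
      have hΦ0_nonneg : 0 ≤ Φ 0 := by rw [hΦ0]; positivity
      gcongr
      · exact ht.2
      · rw [hΦ0]
        have h1 := mul_nonneg (sq_nonneg r) (add_nonneg (sq_nonneg ‖u 0‖) (sq_nonneg ‖w 0‖))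
        have h2 := mul_nonneg (sq_nonneg r) hIv
        have h3 := mul_nonneg (sq_nonneg r) hIf
        linarith
end

section
/- Let H be a real Hilbert space, A : H → H a bounded linear operator, and τ, T > 0. Let u₁, u₂ : [-τ, T] → H be continuous, continuously differentiable on [-τ, 0] and twice continuously differentiable on [0, T], and f : [0, T] → H continuous, such that uᵢ''(t) = A(uᵢ(t - τ)) + f(t) for all t ∈ [0, T] and i = 1, 2. If u₁(t) = u₂(t) for all t ∈ [-τ, 0] and the right derivatives satisfy u₁'(0⁺) = u₂'(0⁺), then u₁(t) = u₂(t) for all t ∈ [0, T]. -/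
open Real Set Filter Topology MeasureTheory

/-- Two functions on `[0, T]` that agree at `0` and have the same derivative on `[0, s]`
agree on `[0, s]`. -/
theorem eqOn_Icc_of_hasDerivWithinAt_eq {E : Type*} [NormedAddCommGroup E] [NormedSpace ℝ E]
    {g₁ g₂ g₁' g₂' : ℝ → E} {s T : ℝ} (hsT : s ≤ T)
    (hg₁ : ∀ t ∈ Set.Icc (0 : ℝ) T, HasDerivWithinAt g₁ (g₁' t) (Set.Icc 0 T) t)
    (hg₂ : ∀ t ∈ Set.Icc (0 : ℝ) T, HasDerivWithinAt g₂ (g₂' t) (Set.Icc 0 T) t)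
    (h' : Set.EqOn g₁' g₂' (Set.Icc 0 s)) (h₀ : g₁ 0 = g₂ 0) :
    Set.EqOn g₁ g₂ (Set.Icc 0 s) := by
  have hd : ∀ t ∈ Set.Icc (0 : ℝ) s, HasDerivWithinAt (g₁ - g₂) 0 (Set.Icc 0 T) t := by
    intro t ht
    have htT : t ∈ Set.Icc (0 : ℝ) T := ⟨ht.1, ht.2.trans hsT⟩
    simpa [h' ht] using (hg₁ t htT).sub (hg₂ t htT)
  intro t ht
  have hconst := constant_of_has_deriv_right_zero (f := g₁ - g₂) (a := 0) (b := s)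
    (fun x hx => (hd x hx).continuousWithinAt.mono (Set.Icc_subset_Icc_right hsT))
    (fun x hx => (hd x (Set.Ico_subset_Icc_self hx)).mono_of_mem_nhdsWithin
      (Icc_mem_nhdsGE_of_mem ⟨hx.1, hx.2.trans_le hsT⟩)) t ht
  simpa [h₀, sub_eq_zero] using hconst

/-- **Uniqueness** for the abstract second-order evolution equation with pure delay
`u''(t) = A u(t - τ) + f(t)` in a real Hilbert space `H`: two classical solutions
(`uᵢ` continuous on `[-τ, T]`, continuously differentiable on `[-τ, 0]` with derivative `vᵢ`,
twice continuously differentiable on `[0, T]` with derivatives `wᵢ`, `wᵢ'`) with the same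
history on `[-τ, 0]` and the same right derivative at `0` (`w₁ 0 = w₂ 0`) coincide on `[0, T]`. -/
theorem uniqueness_delay_wave
    {H : Type*} [NormedAddCommGroup H] [InnerProductSpace ℝ H] [CompleteSpace H]
    (A : H →L[ℝ] H) (τ T : ℝ) (hτ : 0 < τ) (hT : 0 < T)
    (u₁ u₂ v₁ v₂ w₁ w₂ w₁' w₂' f : ℝ → H)
    (hu₁ : ContinuousOn u₁ (Set.Icc (-τ) T))
    (hu₂ : ContinuousOn u₂ (Set.Icc (-τ) T))
    (hv₁ : ∀ t ∈ Set.Icc (-τ) (0 : ℝ), HasDerivWithinAt u₁ (v₁ t) (Set.Icc (-τ) 0) t)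
    (hv₂ : ∀ t ∈ Set.Icc (-τ) (0 : ℝ), HasDerivWithinAt u₂ (v₂ t) (Set.Icc (-τ) 0) t)
    (hv₁c : ContinuousOn v₁ (Set.Icc (-τ) 0))
    (hv₂c : ContinuousOn v₂ (Set.Icc (-τ) 0))
    (hw₁ : ∀ t ∈ Set.Icc (0 : ℝ) T, HasDerivWithinAt u₁ (w₁ t) (Set.Icc 0 T) t)
    (hw₂ : ∀ t ∈ Set.Icc (0 : ℝ) T, HasDerivWithinAt u₂ (w₂ t) (Set.Icc 0 T) t)
    (hw₁' : ∀ t ∈ Set.Icc (0 : ℝ) T, HasDerivWithinAt w₁ (w₁' t) (Set.Icc 0 T) t)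
    (hw₂' : ∀ t ∈ Set.Icc (0 : ℝ) T, HasDerivWithinAt w₂ (w₂' t) (Set.Icc 0 T) t)
    (hw₁'c : ContinuousOn w₁' (Set.Icc 0 T))
    (hw₂'c : ContinuousOn w₂' (Set.Icc 0 T))
    (hf : ContinuousOn f (Set.Icc 0 T))
    (heq₁ : ∀ t ∈ Set.Icc (0 : ℝ) T, w₁' t = A (u₁ (t - τ)) + f t)
    (heq₂ : ∀ t ∈ Set.Icc (0 : ℝ) T, w₂' t = A (u₂ (t - τ)) + f t)
    (hhist : ∀ t ∈ Set.Icc (-τ) (0 : ℝ), u₁ t = u₂ t)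
    (hvel : w₁ 0 = w₂ 0) :
    ∀ t ∈ Set.Icc (0 : ℝ) T, u₁ t = u₂ t := by
  have steps : ∀ n : ℕ, ∀ t ∈ Set.Icc (-τ) T, t ≤ n * τ → u₁ t = u₂ t := by
    intro n
    induction n with
    | zero => exact fun t ht htn => hhist t ⟨ht.1, by simpa using htn⟩
    | succ n ih =>
      intro t ht htn
      rcases le_total t 0 with ht0 | ht0
      · exact hhist t ⟨ht.1, ht0⟩
      push_cast at htn
      have hacc : Set.EqOn w₁' w₂' (Set.Icc 0 t) := by
        intro r hr
        have hrT : r ∈ Set.Icc (0 : ℝ) T := ⟨hr.1, hr.2.trans ht.2⟩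
        rw [heq₁ r hrT, heq₂ r hrT,
          ih (r - τ) ⟨by linarith [hr.1], by linarith [hrT.2]⟩ (by linarith [hr.2])]
      have hw : Set.EqOn w₁ w₂ (Set.Icc 0 t) :=
        eqOn_Icc_of_hasDerivWithinAt_eq ht.2 hw₁' hw₂' hacc hvel
      exact eqOn_Icc_of_hasDerivWithinAt_eq ht.2 hw₁ hw₂ hw
        (hhist 0 ⟨by linarith, le_rfl⟩) ⟨ht0, le_rfl⟩
  intro t ht
  obtain ⟨n, hn⟩ := exists_nat_ge (t / τ)
  exact steps n t ⟨by linarith [ht.1], ht.2⟩ ((div_le_iff₀ hτ).1 hn)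
end

section
/- Let H be a real Hilbert space, A : H → H a bounded linear operator, and τ, T > 0. Let u : [-τ, T] → H be continuous, continuously differentiable on [-τ, T] and twice continuously differentiable on [0, T], and f : [0, T] → H continuous, such that u''(t) = A(u(t - τ)) + f(t) for all t ∈ [0, T]. Define the energy E(t) := ‖u(t)‖² + ‖u'(t)‖² + ∫_{t-τ}^{t} ‖u(s)‖² ds for t ∈ [0, T]. Then E is differentiable on (0, T) and satisfies the differential inequality E'(t) ≤ (2 + ‖A‖²) E(t) + ‖f(t)‖² for all t ∈ (0, T). -/
open Real Set Filter Topology MeasureTheory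

/-- Differentiation of the history term `∫_{s-τ}^{s} g`. -/
lemma hasDerivAt_integral_window {g : ℝ → ℝ} {τ T t : ℝ} (hτ : 0 < τ)
    (hg : ContinuousOn g (Set.Icc (-τ) T)) (ht : t ∈ Set.Ioo (0 : ℝ) T) :
    HasDerivAt (fun s : ℝ => ∫ σ in (s - τ)..s, g σ) (g t - g (t - τ)) t := by
  have hint : ∀ r ∈ Set.Icc (-τ) T, IntervalIntegrable g volume (-τ) r := fun r hr =>
    (hg.mono (Set.Icc_subset_Icc_right hr.2)).intervalIntegrable_of_Icc hr.1
  have hFTC : ∀ r ∈ Set.Ioo (-τ) T, HasDerivAt (fun s => ∫ σ in (-τ)..s, g σ) (g r) r := by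
    intro r hr
    exact intervalIntegral.integral_hasDerivAt_right (hint r (Set.Ioo_subset_Icc_self hr))
      ((hg.mono Set.Ioo_subset_Icc_self).stronglyMeasurableAtFilter isOpen_Ioo r hr)
      (hg.continuousAt (Icc_mem_nhds hr.1 hr.2))
  obtain ⟨ht0, htT⟩ := ht
  have hright := hFTC t ⟨by linarith, htT⟩
  have hleft := (hFTC (t - τ) ⟨by linarith, by linarith⟩).comp_sub_const t τ
  refine (hright.sub hleft).congr_of_eventuallyEq ?_
  filter_upwards [Ioo_mem_nhds ht0 htT] with s hs
  exact (intervalIntegral.integral_interval_sub_left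
    (hint s ⟨by linarith [hs.1], hs.2.le⟩)
    (hint (s - τ) ⟨by linarith [hs.1], by linarith [hs.2]⟩)).symm

/-- Young's inequality for the inner product. -/
lemma two_mul_inner_le_norm_sq_add_norm_sq {H : Type*} [NormedAddCommGroup H]
    [InnerProductSpace ℝ H] (x y : H) : 2 * inner ℝ x y ≤ ‖x‖ ^ 2 + ‖y‖ ^ 2 := by
  nlinarith [real_inner_le_norm x y, sq_nonneg (‖x‖ - ‖y‖)]

/-- Young's inequality with a bounded operator in the second argument. -/
lemma two_mul_inner_apply_le {H : Type*} [NormedAddCommGroup H]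
    [InnerProductSpace ℝ H] (A : H →L[ℝ] H) (x y : H) :
    2 * inner ℝ x (A y) ≤ ‖A‖ ^ 2 * ‖x‖ ^ 2 + ‖y‖ ^ 2 := by
  have h := mul_le_mul_of_nonneg_left (A.le_opNorm y) (norm_nonneg x)
  nlinarith [real_inner_le_norm x (A y), sq_nonneg (‖A‖ * ‖x‖ - ‖y‖)]

/-- **Energy differential inequality** (Equation (1.6)) for the abstract second-order
evolution equation with pure delay `u''(t) = A u(t - τ) + f(t)` in a real Hilbert space `H`:
if `u` is continuous on `[-τ, T]`, continuously differentiable on `[-τ, T]` with derivative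
`v` and twice continuously differentiable on `[0, T]` with second derivative `w`, then the
energy `E(t) = ‖u(t)‖² + ‖u'(t)‖² + ∫_{t-τ}^{t} ‖u(s)‖² ds` is differentiable on `(0, T)`
and `E'(t) ≤ (2 + ‖A‖²) E(t) + ‖f(t)‖²` there. -/
theorem energy_differential_inequality_delay_wave
    {H : Type*} [NormedAddCommGroup H] [InnerProductSpace ℝ H] [CompleteSpace H]
    (A : H →L[ℝ] H) (τ T : ℝ) (hτ : 0 < τ) (hT : 0 < T)
    (u v w f : ℝ → H)
    (hu : ContinuousOn u (Set.Icc (-τ) T))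
    (hv : ∀ t ∈ Set.Icc (-τ) T, HasDerivWithinAt u (v t) (Set.Icc (-τ) T) t)
    (hvc : ContinuousOn v (Set.Icc (-τ) T))
    (hw : ∀ t ∈ Set.Icc (0 : ℝ) T, HasDerivWithinAt v (w t) (Set.Icc 0 T) t)
    (hwc : ContinuousOn w (Set.Icc 0 T))
    (hf : ContinuousOn f (Set.Icc 0 T))
    (heq : ∀ t ∈ Set.Icc (0 : ℝ) T, w t = A (u (t - τ)) + f t) :
    ∀ t ∈ Set.Ioo (0 : ℝ) T, ∃ D : ℝ,
      HasDerivAt (fun s : ℝ => ‖u s‖ ^ 2 + ‖v s‖ ^ 2 + ∫ σ in (s - τ)..s, ‖u σ‖ ^ 2) D t ∧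
      D ≤ (2 + ‖A‖ ^ 2) * (‖u t‖ ^ 2 + ‖v t‖ ^ 2 + ∫ σ in (t - τ)..t, ‖u σ‖ ^ 2) + ‖f t‖ ^ 2 := by
  intro t ht
  have hu' : HasDerivAt u (v t) t :=
    (hv t ⟨by linarith [ht.1], ht.2.le⟩).hasDerivAt (Icc_mem_nhds (by linarith [ht.1]) ht.2)
  have hv' : HasDerivAt v (w t) t :=
    (hw t (Set.Ioo_subset_Icc_self ht)).hasDerivAt (Icc_mem_nhds ht.1 ht.2)
  refine ⟨_, (hu'.norm_sq.add hv'.norm_sq).add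
    (hasDerivAt_integral_window hτ (hu.norm.pow 2) ht), ?_⟩
  rw [heq t (Set.Ioo_subset_Icc_self ht), inner_add_right]
  have hI : 0 ≤ ∫ σ in (t - τ)..t, ‖u σ‖ ^ 2 :=
    intervalIntegral.integral_nonneg (by linarith) fun σ _ => sq_nonneg _
  have huv := two_mul_inner_le_norm_sq_add_norm_sq (u t) (v t)
  have hvA := two_mul_inner_apply_le A (v t) (u (t - τ))
  have hvf := two_mul_inner_le_norm_sq_add_norm_sq (v t) (f t)
  have hAu : 0 ≤ ‖A‖ ^ 2 * ‖u t‖ ^ 2 := by positivity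
  have hAI := mul_nonneg (sq_nonneg ‖A‖) hI
  linarith
end

section
/- Let τ > 0 and ω > 0. The delay sine function sin_τ(ω,·) is continuous on all of ℝ, and the delay cosine function cos_τ(ω,·) is continuous on (-τ, ∞); in particular, at each node t = kτ with integer k ≥ 0, the polynomial pieces of cos_τ(ω,·) and sin_τ(ω,·) on the adjacent intervals [(k-1)τ, kτ) and [kτ, (k+1)τ) take the same value at t = kτ. -/
open Real Set Filter Topology MeasureTheory

/-- `C` is the delay cosine function `cos_τ(ω, ·)`: it vanishes for `t < -τ` and, for every
integer `k ≥ 0` and `(k-1)τ ≤ t < kτ`, equals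
`∑_{j=0}^{k} (-1)^j ω^(2j) (t-(j-1)τ)^(2j) / (2j)!`. -/
def IsDelayCos (τ ω : ℝ) (C : ℝ → ℝ) : Prop :=
  (∀ t : ℝ, t < -τ → C t = 0) ∧
  ∀ (k : ℕ) (t : ℝ), ((k : ℝ) - 1) * τ ≤ t → t < (k : ℝ) * τ →
    C t = ∑ j ∈ Finset.range (k + 1),
      (-1 : ℝ) ^ j * ω ^ (2 * j) * (t - ((j : ℝ) - 1) * τ) ^ (2 * j) / ((2 * j).factorial : ℝ)

/-- `S` is the delay sine function `sin_τ(ω, ·)`: it vanishes for `t < -τ` and, for every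
integer `k ≥ 0` and `(k-1)τ ≤ t < kτ`, equals
`∑_{j=0}^{k} (-1)^j ω^(2j+1) (t-(j-1)τ)^(2j+1) / (2j+1)!`. -/
def IsDelaySin (τ ω : ℝ) (S : ℝ → ℝ) : Prop :=
  (∀ t : ℝ, t < -τ → S t = 0) ∧
  ∀ (k : ℕ) (t : ℝ), ((k : ℝ) - 1) * τ ≤ t → t < (k : ℝ) * τ →
    S t = ∑ j ∈ Finset.range (k + 1),
      (-1 : ℝ) ^ j * ω ^ (2 * j + 1) * (t - ((j : ℝ) - 1) * τ) ^ (2 * j + 1) / ((2 * j + 1).factorial : ℝ)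

/-- If `f` is given on each `[(k-1)τ, kτ)` by `∑_{j ≤ k} p j (t - (j-1)τ)`, where `p j 0 = 0` for
`j ≥ 1`, then on `[-τ, nτ)` it is a single sum of truncated pieces. -/
theorem eq_sum_max_of_piecewise {τ : ℝ} (hτ : 0 < τ) {p : ℕ → ℝ → ℝ} {f : ℝ → ℝ}
    (hp0 : ∀ j, p (j + 1) 0 = 0)
    (hf : ∀ (k : ℕ) (t : ℝ), ((k : ℝ) - 1) * τ ≤ t → t < (k : ℝ) * τ →
      f t = ∑ j ∈ Finset.range (k + 1), p j (t - ((j : ℝ) - 1) * τ))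
    (n : ℕ) {t : ℝ} (ht : -τ ≤ t) (htn : t < n * τ) :
    f t = ∑ j ∈ Finset.range (n + 1), p j (max (t - ((j : ℝ) - 1) * τ) 0) := by
  induction n with
  | zero =>
    rw [hf 0 t (by simpa using ht) htn]
    simp [show 0 ≤ t + τ by linarith]
  | succ n ih =>
    rcases lt_or_ge t (n * τ) with h | h
    · rw [Finset.sum_range_succ, ← ih h, max_eq_right (by push_cast; linarith), hp0, add_zero]
    · rw [hf (n + 1) t (by push_cast; linarith) htn]
      refine Finset.sum_congr rfl fun j hj => ?_
      have hjn : (j : ℝ) ≤ n + 1 := by exact_mod_cast Nat.lt_succ_iff.mp (Finset.mem_range.mp hj)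
      rw [max_eq_left (by nlinarith)]

theorem continuousOn_Ioi_of_piecewise {τ : ℝ} (hτ : 0 < τ) {p : ℕ → ℝ → ℝ} {f : ℝ → ℝ}
    (hp : ∀ j, Continuous (p j)) (hp0 : ∀ j, p (j + 1) 0 = 0)
    (hf : ∀ (k : ℕ) (t : ℝ), ((k : ℝ) - 1) * τ ≤ t → t < (k : ℝ) * τ →
      f t = ∑ j ∈ Finset.range (k + 1), p j (t - ((j : ℝ) - 1) * τ)) :
    ContinuousOn f (Ioi (-τ)) := by
  intro x hx
  obtain ⟨n, hn⟩ := exists_nat_gt (x / τ)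
  rw [div_lt_iff₀ hτ] at hn
  have hcont : Continuous fun t : ℝ =>
      ∑ j ∈ Finset.range (n + 1), p j (max (t - ((j : ℝ) - 1) * τ) 0) :=
    continuous_finsetSum _ fun j _ => (hp j).comp (by fun_prop)
  refine (hcont.continuousAt.congr ?_).continuousWithinAt
  filter_upwards [Ioo_mem_nhds hx hn] with t ht
  exact (eq_sum_max_of_piecewise hτ hp0 hf n ht.1.le ht.2).symm

theorem continuous_of_piecewise {τ : ℝ} (hτ : 0 < τ) {p : ℕ → ℝ → ℝ} {f : ℝ → ℝ}
    (hp : ∀ j, Continuous (p j)) (hp0 : ∀ j, p j 0 = 0) (hf0 : ∀ t < -τ, f t = 0)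
    (hf : ∀ (k : ℕ) (t : ℝ), ((k : ℝ) - 1) * τ ≤ t → t < (k : ℝ) * τ →
      f t = ∑ j ∈ Finset.range (k + 1), p j (t - ((j : ℝ) - 1) * τ)) :
    Continuous f := by
  rw [continuous_iff_continuousAt]
  intro x
  rcases lt_or_ge (-τ) x with hx | hx
  · exact (continuousOn_Ioi_of_piecewise hτ hp (fun j => hp0 (j + 1)) hf).continuousAt
      (Ioi_mem_nhds hx)
  · have hcont : Continuous fun t : ℝ => p 0 (max (t + τ) 0) := (hp 0).comp (by fun_prop)
    refine hcont.continuousAt.congr ?_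
    filter_upwards [Iio_mem_nhds (show x < 0 by linarith)] with t ht
    rcases lt_or_ge t (-τ) with h | h
    · rw [hf0 t h, max_eq_right (by linarith), hp0]
    · rw [hf 0 t (by simpa using h) (by simpa using ht), max_eq_left (by linarith)]
      simp

/-- **Continuity of the delay sine and cosine** (`τ > 0`, `ω > 0`): the delay sine
`sin_τ(ω,·)` is continuous on all of `ℝ` and the delay cosine `cos_τ(ω,·)` is continuous on
`(-τ, ∞)`; in particular, at each node `t = kτ` (`k ≥ 0`) the polynomial pieces of
`cos_τ(ω,·)` and `sin_τ(ω,·)` on the adjacent intervals `[(k-1)τ, kτ)` and `[kτ, (k+1)τ)`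
take the same value at `t = kτ`. -/
theorem delay_sin_cos_continuous (τ ω : ℝ) (hτ : 0 < τ) (hω : 0 < ω)
    (dc ds : ℝ → ℝ) (hc : IsDelayCos τ ω dc) (hs : IsDelaySin τ ω ds) :
    Continuous ds ∧
    ContinuousOn dc (Set.Ioi (-τ)) ∧
    (∀ k : ℕ,
      ∑ j ∈ Finset.range (k + 1),
          (-1 : ℝ) ^ j * ω ^ (2 * j) * ((k : ℝ) * τ - ((j : ℝ) - 1) * τ) ^ (2 * j) /
            ((2 * j).factorial : ℝ) =
        ∑ j ∈ Finset.range (k + 2),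
          (-1 : ℝ) ^ j * ω ^ (2 * j) * ((k : ℝ) * τ - ((j : ℝ) - 1) * τ) ^ (2 * j) /
            ((2 * j).factorial : ℝ)) ∧
    (∀ k : ℕ,
      ∑ j ∈ Finset.range (k + 1),
          (-1 : ℝ) ^ j * ω ^ (2 * j + 1) * ((k : ℝ) * τ - ((j : ℝ) - 1) * τ) ^ (2 * j + 1) /
            ((2 * j + 1).factorial : ℝ) =
        ∑ j ∈ Finset.range (k + 2),
          (-1 : ℝ) ^ j * ω ^ (2 * j + 1) * ((k : ℝ) * τ - ((j : ℝ) - 1) * τ) ^ (2 * j + 1) /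
            ((2 * j + 1).factorial : ℝ)) := by
  refine ⟨?_, ?_, fun k => ?_, fun k => ?_⟩
  · exact continuous_of_piecewise hτ
      (p := fun j x => (-1 : ℝ) ^ j * ω ^ (2 * j + 1) * x ^ (2 * j + 1) / ((2 * j + 1).factorial : ℝ))
      (fun j => by fun_prop) (fun j => by simp) hs.1 hs.2
  · exact continuousOn_Ioi_of_piecewise hτ
      (p := fun j x => (-1 : ℝ) ^ j * ω ^ (2 * j) * x ^ (2 * j) / ((2 * j).factorial : ℝ))
      (fun j => by fun_prop) (fun j => by simp) hc.2
  · rw [Finset.sum_range_succ _ (k + 1)]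
    simp
  · rw [Finset.sum_range_succ _ (k + 1)]
    simp
end

section
/- Let τ > 0 and ω > 0. The delay sine function t ↦ sin_τ(ω,t) is differentiable at every t ∈ (-τ, ∞), and its derivative satisfies d/dt sin_τ(ω,t) = ω cos_τ(ω,t) for all t ∈ (-τ, ∞). -/
open Real Set Filter Topology MeasureTheory

/-- The truncated power `x ↦ (max x 0) ^ (n + 1)` is differentiable away from the origin, and also
at the origin when its exponent is at least two. -/
theorem hasDerivAt_max_zero_pow (n : ℕ) (x : ℝ) (h : 0 < x ∨ n ≠ 0) :
    HasDerivAt (fun y : ℝ => (max y 0) ^ (n + 1)) (((n : ℝ) + 1) * (max x 0) ^ n) x := by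
  rcases lt_trichotomy x 0 with hx | rfl | hx
  · have hn : n ≠ 0 := h.resolve_left hx.not_gt
    rw [max_eq_right hx.le, zero_pow hn, mul_zero]
    refine (hasDerivAt_const x (0 : ℝ)).congr_of_eventuallyEq ?_
    filter_upwards [Iio_mem_nhds hx] with y hy
    simp [max_eq_right (mem_Iio.mp hy).le]
  · have hn : n ≠ 0 := h.resolve_left (lt_irrefl 0)
    rw [max_self, zero_pow hn, mul_zero, hasDerivAt_iff_isLittleO]
    have hpow : (fun y : ℝ => y ^ (n + 1)) =o[𝓝 0] fun y : ℝ => y := by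
      simpa using Asymptotics.isLittleO_pow_pow (𝕜 := ℝ) (show 1 < n + 1 by lia)
    refine (Asymptotics.IsBigO.of_bound 1 (Eventually.of_forall fun y => ?_)).trans_isLittleO
      (by simpa using hpow)
    have hy : |max y 0| ≤ |y| := by
      rw [abs_of_nonneg (le_max_right y 0)]
      exact max_le (le_abs_self y) (abs_nonneg y)
    simpa using pow_le_pow_left₀ (abs_nonneg _) hy (n + 1)
  · rw [max_eq_left hx.le]
    have hd : HasDerivAt (fun y : ℝ => y ^ (n + 1)) (((n : ℝ) + 1) * x ^ n) x := by
      simpa using hasDerivAt_pow (n + 1) x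
    refine hd.congr_of_eventuallyEq ?_
    filter_upwards [Ioi_mem_nhds hx] with y hy
    rw [max_eq_left (mem_Ioi.mp hy).le]

/-- A function given on each delay interval by a partial sum of shifted powers is, on
`[-τ, Mτ)`, a single sum of truncated powers. -/
theorem eq_sum_max_zero_pow {τ : ℝ} (hτ : 0 < τ) {f : ℝ → ℝ} {a : ℕ → ℝ} {p : ℕ → ℕ}
    (hp : ∀ j, j ≠ 0 → p j ≠ 0)
    (hf : ∀ (k : ℕ) (t : ℝ), ((k : ℝ) - 1) * τ ≤ t → t < (k : ℝ) * τ →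
      f t = ∑ j ∈ Finset.range (k + 1), a j * (t - ((j : ℝ) - 1) * τ) ^ p j)
    {M : ℕ} {t : ℝ} (ht : -τ ≤ t) (htM : t < (M : ℝ) * τ) :
    f t = ∑ j ∈ Finset.range (M + 1), a j * (max (t - ((j : ℝ) - 1) * τ) 0) ^ p j := by
  have hnonneg : 0 ≤ (t + τ) / τ := div_nonneg (by linarith) hτ.le
  obtain ⟨k, hk₁, hk₂⟩ : ∃ k : ℕ, ((k : ℝ) - 1) * τ ≤ t ∧ t < (k : ℝ) * τ := by
    refine ⟨⌊(t + τ) / τ⌋₊, ?_, ?_⟩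
    · have := (le_div_iff₀ hτ).mp (Nat.floor_le hnonneg)
      linarith
    · have := (div_lt_iff₀ hτ).mp (Nat.lt_floor_add_one ((t + τ) / τ))
      linarith
  have hkM : k ≤ M := by
    have : ((k : ℝ) - 1) < M := lt_of_mul_lt_mul_right (hk₁.trans_lt htM) hτ.le
    have : (k : ℝ) < (M + 1 : ℕ) := by push_cast; linarith
    exact Nat.lt_succ_iff.mp (Nat.cast_lt.mp this)
  rw [hf k t hk₁ hk₂]
  have hsub : Finset.range (k + 1) ⊆ Finset.range (M + 1) :=
    Finset.range_subset_range.mpr (by lia)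
  rw [← Finset.sum_subset hsub]
  · refine Finset.sum_congr rfl fun j hj => ?_
    have hjk : (j : ℝ) ≤ k := Nat.cast_le.mpr (Nat.lt_succ_iff.mp (Finset.mem_range.mp hj))
    rw [max_eq_left]
    nlinarith
  · intro j _ hj
    have hkj : k + 1 ≤ j := not_lt.mp fun h => hj (Finset.mem_range.mpr h)
    have hkj' : (k : ℝ) + 1 ≤ j := by exact_mod_cast hkj
    rw [max_eq_right (by nlinarith), zero_pow (hp j (by lia)), mul_zero]

/-- **Derivative of the delay sine** (`τ > 0`, `ω > 0`): the delay sine `sin_τ(ω,·)` is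
differentiable at every `t ∈ (-τ, ∞)` with `d/dt sin_τ(ω,t) = ω cos_τ(ω,t)`. -/
theorem delay_sin_hasDerivAt (τ ω : ℝ) (hτ : 0 < τ) (hω : 0 < ω)
    (dc ds : ℝ → ℝ) (hc : IsDelayCos τ ω dc) (hs : IsDelaySin τ ω ds) :
    ∀ t ∈ Set.Ioi (-τ), HasDerivAt ds (ω * dc t) t := by
  intro t ht
  obtain ⟨M, hM⟩ := exists_nat_gt (t / τ)
  have htM : t < (M : ℝ) * τ := (div_lt_iff₀ hτ).mp hM
  have hcos := eq_sum_max_zero_pow (M := M) (t := t) (f := dc) hτ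
    (a := fun j => (-1 : ℝ) ^ j * ω ^ (2 * j) / ((2 * j).factorial : ℝ)) (p := fun j => 2 * j)
    (fun j hj => by lia)
    (fun k s h₁ h₂ => (hc.2 k s h₁ h₂).trans
      (Finset.sum_congr rfl fun j _ => mul_div_right_comm _ _ _)) (mem_Ioi.mp ht).le htM
  have hsin : ∀ s : ℝ, -τ ≤ s → s < (M : ℝ) * τ → _ := fun s h h' =>
    eq_sum_max_zero_pow (M := M) (t := s) (f := ds) hτ
    (a := fun j => (-1 : ℝ) ^ j * ω ^ (2 * j + 1) / ((2 * j + 1).factorial : ℝ))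
    (p := fun j => 2 * j + 1) (fun j _ => by lia)
    (fun k s h₁ h₂ => (hs.2 k s h₁ h₂).trans
      (Finset.sum_congr rfl fun j _ => mul_div_right_comm _ _ _)) h h'
  have hterm : ∀ j ∈ Finset.range (M + 1), HasDerivAt
      (fun s : ℝ => (-1 : ℝ) ^ j * ω ^ (2 * j + 1) / ((2 * j + 1).factorial : ℝ) *
        (max (s - ((j : ℝ) - 1) * τ) 0) ^ (2 * j + 1))
      (ω * ((-1 : ℝ) ^ j * ω ^ (2 * j) / ((2 * j).factorial : ℝ) *
        (max (t - ((j : ℝ) - 1) * τ) 0) ^ (2 * j))) t := by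
    intro j _
    have hj : 0 < t - ((j : ℝ) - 1) * τ ∨ 2 * j ≠ 0 := by
      rcases Nat.eq_zero_or_pos j with rfl | hj
      · left
        have := mem_Ioi.mp ht
        push_cast
        linarith
      · right
        lia
    have hd := ((hasDerivAt_max_zero_pow (2 * j) _ hj).comp_sub_const t
      (((j : ℝ) - 1) * τ)).const_mul
      ((-1 : ℝ) ^ j * ω ^ (2 * j + 1) / ((2 * j + 1).factorial : ℝ))
    refine hd.congr_deriv ?_
    have h₁ : ((2 * j).factorial : ℝ) ≠ 0 := Nat.cast_ne_zero.mpr (Nat.factorial_ne_zero _)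
    have h₂ : ((2 * j : ℕ) : ℝ) + 1 ≠ 0 := Nat.cast_add_one_ne_zero _
    rw [Nat.factorial_succ, Nat.cast_mul, Nat.cast_succ]
    field_simp
    ring
  rw [hcos, Finset.mul_sum]
  refine (HasDerivAt.fun_sum hterm).congr_of_eventuallyEq ?_
  filter_upwards [Ioo_mem_nhds (mem_Ioi.mp ht) htM] with s hs'
  exact hsin s hs'.1.le hs'.2
end

section
/- Let τ > 0 and ω > 0. The delay sine x(t) := sin_τ(ω,t) solves the linear homogeneous second-order delay differential equation with pure delay subject to linear initial conditions: x(t) = ω(t + τ) for all t ∈ [-τ, 0), and x is twice differentiable at every t ∈ (0, ∞) with x''(t) + ω² x(t - τ) = 0 for all t ∈ (0, ∞). -/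
open Real Set Filter Topology MeasureTheory

/-- The truncated power `max x 0 ^ n / n!`. -/
noncomputable def truncPow (n : ℕ) (x : ℝ) : ℝ := max x 0 ^ n / (n.factorial : ℝ)

lemma truncPow_of_nonneg (n : ℕ) {x : ℝ} (hx : 0 ≤ x) :
    truncPow n x = x ^ n / (n.factorial : ℝ) := by
  rw [truncPow, max_eq_left hx]

lemma truncPow_succ_of_nonpos (n : ℕ) {x : ℝ} (hx : x ≤ 0) : truncPow (n + 1) x = 0 := by
  simp [truncPow, max_eq_right hx]

lemma hasDerivAt_pow_succ_div_factorial (n : ℕ) (x : ℝ) :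
    HasDerivAt (fun y : ℝ => y ^ (n + 1) / ((n + 1).factorial : ℝ))
      (x ^ n / (n.factorial : ℝ)) x := by
  refine ((hasDerivAt_pow (n + 1) x).div_const _).congr_deriv ?_
  rw [Nat.factorial_succ, Nat.add_sub_cancel]
  have h : (n.factorial : ℝ) ≠ 0 := by positivity
  have h' : ((n : ℝ) + 1) ≠ 0 := by positivity
  push_cast
  field_simp

lemma hasDerivAt_truncPow_of_pos (n : ℕ) {x : ℝ} (hx : 0 < x) :
    HasDerivAt (truncPow (n + 1)) (truncPow n x) x := by
  rw [truncPow_of_nonneg n hx.le]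
  refine (hasDerivAt_pow_succ_div_factorial n x).congr_of_eventuallyEq ?_
  filter_upwards [lt_mem_nhds hx] with y hy using truncPow_of_nonneg _ hy.le

lemma hasDerivAt_truncPow (n : ℕ) (x : ℝ) :
    HasDerivAt (truncPow (n + 2)) (truncPow (n + 1) x) x := by
  rcases lt_trichotomy x 0 with hx | rfl | hx
  · rw [truncPow_succ_of_nonpos n hx.le]
    refine (hasDerivAt_const x (0 : ℝ)).congr_of_eventuallyEq ?_
    filter_upwards [gt_mem_nhds hx] with y hy using truncPow_succ_of_nonpos _ hy.le
  · rw [← hasDerivWithinAt_univ, ← Set.Iic_union_Ici (a := (0 : ℝ))]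
    refine HasDerivWithinAt.union ?_ ?_
    · rw [truncPow_succ_of_nonpos n le_rfl]
      exact (hasDerivWithinAt_const (0 : ℝ) (Set.Iic 0) (0 : ℝ)).congr
        (fun y hy => truncPow_succ_of_nonpos _ hy) (truncPow_succ_of_nonpos _ le_rfl)
    · rw [truncPow_of_nonneg _ le_rfl]
      exact (hasDerivAt_pow_succ_div_factorial (n + 1) 0).hasDerivWithinAt.congr
        (fun y hy => truncPow_of_nonneg _ hy) (truncPow_of_nonneg _ le_rfl)
  · exact hasDerivAt_truncPow_of_pos (n + 1) hx

/-- To the left of `N * τ` the delay sine is a single sum of truncated powers. -/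
lemma IsDelaySin.eq_sum_truncPow {τ ω : ℝ} (hτ : 0 < τ) {S : ℝ → ℝ} (hS : IsDelaySin τ ω S)
    (N : ℕ) {t : ℝ} (ht : t < N * τ) :
    S t = ∑ j ∈ Finset.range (N + 1),
      (-1 : ℝ) ^ j * ω ^ (2 * j + 1) * truncPow (2 * j + 1) (t - ((j : ℝ) - 1) * τ) := by
  rcases lt_or_ge t (-τ) with h | h
  · rw [hS.1 t h, Finset.sum_eq_zero]
    intro j _
    rw [truncPow_succ_of_nonpos, mul_zero]
    nlinarith [mul_nonneg (Nat.cast_nonneg (α := ℝ) j) hτ.le]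
  · have h0 : 0 ≤ (t + τ) / τ := div_nonneg (by linarith) hτ.le
    set k := ⌊(t + τ) / τ⌋₊ with hk
    have hk1 : (k : ℝ) * τ ≤ t + τ := (le_div_iff₀ hτ).1 (Nat.floor_le h0)
    have hk2 : t + τ < ((k : ℝ) + 1) * τ := (div_lt_iff₀ hτ).1 (Nat.lt_floor_add_one _)
    have hkN : k < N + 1 := by
      have : (k : ℝ) < N + 1 := lt_of_mul_lt_mul_right (by linarith) hτ.le
      exact_mod_cast this
    rw [hS.2 k t (by linarith) (by linarith)]
    rw [← Finset.sum_subset (Finset.range_mono (show k + 1 ≤ N + 1 by omega))]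
    · refine Finset.sum_congr rfl fun j hj => ?_
      have hjk : (j : ℝ) ≤ k := by
        exact_mod_cast Nat.lt_succ_iff.1 (Finset.mem_range.1 hj)
      rw [truncPow_of_nonneg, mul_div_assoc]
      nlinarith [mul_le_mul_of_nonneg_right hjk hτ.le]
    · intro j _ hj
      have hjk : (k : ℝ) + 1 ≤ j := by
        exact_mod_cast not_lt.1 (mt Finset.mem_range.2 hj)
      rw [truncPow_succ_of_nonpos, mul_zero]
      nlinarith [mul_le_mul_of_nonneg_right hjk hτ.le]

/-- The first derivative of the delay sine on `(0, (N + 1) * τ)`. -/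
lemma IsDelaySin.hasDerivAt {τ ω : ℝ} (hτ : 0 < τ) {S : ℝ → ℝ} (hS : IsDelaySin τ ω S)
    (N : ℕ) {t : ℝ} (ht0 : 0 < t) (ht : t < ((N + 1 : ℕ) : ℝ) * τ) :
    HasDerivAt S ((∑ j ∈ Finset.range (N + 1),
      (-1 : ℝ) ^ (j + 1) * ω ^ (2 * j + 3) * truncPow (2 * j + 2) (t - j * τ)) + ω) t := by
  have key : HasDerivAt (fun s => (∑ j ∈ Finset.range (N + 1),
      (-1 : ℝ) ^ (j + 1) * ω ^ (2 * j + 3) * truncPow (2 * j + 3) (s - j * τ)) +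
      ω * truncPow 1 (s + τ)) ((∑ j ∈ Finset.range (N + 1),
      (-1 : ℝ) ^ (j + 1) * ω ^ (2 * j + 3) * truncPow (2 * j + 2) (t - j * τ)) + ω) t := by
    refine HasDerivAt.add (HasDerivAt.fun_sum fun j _ => ?_) ?_
    · exact ((hasDerivAt_truncPow (2 * j + 1) _).comp_sub_const t _).const_mul _
    · refine (((hasDerivAt_truncPow_of_pos 0
        (show 0 < t + τ by linarith)).comp_add_const t τ).const_mul ω).congr_deriv ?_
      simp [truncPow]
  refine key.congr_of_eventuallyEq ?_
  filter_upwards [gt_mem_nhds ht] with s hs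
  rw [hS.eq_sum_truncPow hτ (N + 1) hs, Finset.sum_range_succ']
  congr 1
  · refine Finset.sum_congr rfl fun j _ => ?_
    push_cast
    rw [add_sub_cancel_right]
    rfl
  · simp

/-- **The delay sine solves the pure-delay oscillator with linear initial data**
(`τ > 0`, `ω > 0`): `x = sin_τ(ω,·)` satisfies `x(t) = ω (t + τ)` on `[-τ, 0)` and is twice
differentiable at every `t ∈ (0, ∞)` with `x''(t) + ω² x(t - τ) = 0` there. -/
theorem delay_sin_solves_ivp (τ ω : ℝ) (hτ : 0 < τ) (hω : 0 < ω)
    (ds : ℝ → ℝ) (hs : IsDelaySin τ ω ds) :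
    (∀ t ∈ Set.Ico (-τ) (0 : ℝ), ds t = ω * (t + τ)) ∧
    ∃ ds' : ℝ → ℝ,
      (∀ t ∈ Set.Ioi (0 : ℝ), HasDerivAt ds (ds' t) t) ∧
      ∀ t ∈ Set.Ioi (0 : ℝ), HasDerivAt ds' (-(ω ^ 2 * ds (t - τ))) t := by
  have exists_bound (t : ℝ) : ∃ N : ℕ, t < ((N + 1 : ℕ) : ℝ) * τ := by
    obtain ⟨N, hN⟩ := exists_nat_gt (t / τ)
    refine ⟨N, ((div_lt_iff₀ hτ).1 hN).trans ?_⟩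
    push_cast
    linarith
  refine ⟨fun t ht => ?_, deriv ds, fun t ht => ?_, fun t ht => ?_⟩
  · rw [hs.2 0 t (by simpa using ht.1) (by simpa using ht.2)]
    simp
  · obtain ⟨N, hN⟩ := exists_bound t
    exact (hs.hasDerivAt hτ N ht hN).differentiableAt.hasDerivAt
  · obtain ⟨N, hN⟩ := exists_bound t
    have key : HasDerivAt (fun s => (∑ j ∈ Finset.range (N + 1),
        (-1 : ℝ) ^ (j + 1) * ω ^ (2 * j + 3) * truncPow (2 * j + 2) (s - j * τ)) + ω)
        (∑ j ∈ Finset.range (N + 1),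
        (-1 : ℝ) ^ (j + 1) * ω ^ (2 * j + 3) * truncPow (2 * j + 1) (t - j * τ)) t := by
      refine (HasDerivAt.fun_sum fun j _ => ?_).add_const ω
      exact ((hasDerivAt_truncPow (2 * j) _).comp_sub_const t _).const_mul _
    have hsum : -(ω ^ 2 * ds (t - τ)) = ∑ j ∈ Finset.range (N + 1),
        (-1 : ℝ) ^ (j + 1) * ω ^ (2 * j + 3) * truncPow (2 * j + 1) (t - j * τ) := by
      rw [hs.eq_sum_truncPow hτ N (by push_cast at hN; linarith), Finset.mul_sum,
        ← Finset.sum_neg_distrib]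
      refine Finset.sum_congr rfl fun j _ => ?_
      rw [show t - τ - ((j : ℝ) - 1) * τ = t - j * τ by ring]
      ring
    rw [hsum]
    refine key.congr_of_eventuallyEq ?_
    filter_upwards [gt_mem_nhds hN, lt_mem_nhds ht] with s hsN hs0
    exact (hs.hasDerivAt hτ N hs0 hsN).deriv
end

section
/- Let τ > 0, ω > 0, T > 0, and let f : [0, T] → ℝ be continuous. Define x : [-τ, T] → ℝ by x(t) = 0 for t ∈ [-τ, 0] and x(t) = (1/ω) ∫_{0}^{t} sin_τ(ω, t - τ - s) f(s) ds for t ∈ [0, T]. Then x is continuously differentiable on [-τ, T], twice differentiable at every t ∈ (0, T), and satisfies x''(t) + ω² x(t - τ) = f(t) for all t ∈ (0, T). -/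
open Real Set Filter Topology MeasureTheory

/-- The primitive of `g` based at `0`. -/
noncomputable def primitive (g : ℝ → ℝ) (u : ℝ) : ℝ := ∫ s in (0 : ℝ)..u, g s

lemma hasDerivAt_primitive {g : ℝ → ℝ} (hg : Continuous g) (u : ℝ) :
    HasDerivAt (primitive g) (g u) u :=
  intervalIntegral.integral_hasDerivAt_right (hg.intervalIntegrable _ _)
    (hg.stronglyMeasurableAtFilter _ _) hg.continuousAt

lemma continuous_primitive {g : ℝ → ℝ} (hg : Continuous g) : Continuous (primitive g) :=
  continuous_iff_continuousAt.2 fun u => (hasDerivAt_primitive hg u).continuousAt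

lemma continuous_iterate_primitive {g : ℝ → ℝ} (hg : Continuous g) (n : ℕ) :
    Continuous (primitive^[n] g) := by
  induction n with
  | zero => exact hg
  | succ n ih => rw [Function.iterate_succ_apply']; exact continuous_primitive ih

/-- Cauchy's formula for repeated integration. -/
lemma integral_pow_mul_eq_iterate_primitive (n : ℕ) {g : ℝ → ℝ} (hg : Continuous g) (u : ℝ) :
    ∫ s in (0 : ℝ)..u, (u - s) ^ n / (n.factorial : ℝ) * g s = primitive^[n + 1] g u := by
  induction n generalizing g with
  | zero => simp [primitive]
  | succ n ih =>
    rw [Function.iterate_succ_apply, ← ih (continuous_primitive hg)]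
    have hfac : ((n + 1).factorial : ℝ) = (n + 1) * n.factorial := by
      rw [Nat.factorial_succ]; push_cast; ring
    have hpos : (n.factorial : ℝ) ≠ 0 := by positivity
    have hker : ∀ s : ℝ, HasDerivAt (fun s : ℝ => (u - s) ^ (n + 1) / ((n + 1).factorial : ℝ))
        (-((u - s) ^ n / (n.factorial : ℝ))) s := by
      intro s
      refine ((((hasDerivAt_id s).const_sub u).fun_pow (n + 1)).div_const
        ((n + 1).factorial : ℝ)).congr_deriv ?_
      rw [hfac]
      simp only [id, Nat.add_sub_cancel]
      push_cast
      field_simp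
    have hparts := intervalIntegral.integral_mul_deriv_eq_deriv_mul (a := 0) (b := u)
      (fun s _ => hker s) (fun s _ => hasDerivAt_primitive hg s)
      (Continuous.intervalIntegrable (by fun_prop) _ _) (hg.intervalIntegrable _ _)
    rw [hparts]
    simp [primitive]

/-- The `(n + 1)`-fold primitive of the restriction of `g` to the positive half-line. -/
noncomputable def causalPrimitive (g : ℝ → ℝ) (n : ℕ) : ℝ → ℝ :=
  primitive^[n] fun u => primitive g (max u 0)

lemma continuous_causalPrimitive {g : ℝ → ℝ} (hg : Continuous g) (n : ℕ) :
    Continuous (causalPrimitive g n) :=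
  continuous_iterate_primitive
    ((continuous_primitive hg).comp (continuous_id.max continuous_const)) n

lemma causalPrimitive_succ (g : ℝ → ℝ) (n : ℕ) :
    causalPrimitive g (n + 1) = primitive (causalPrimitive g n) :=
  Function.iterate_succ_apply' ..

lemma hasDerivAt_causalPrimitive_succ {g : ℝ → ℝ} (hg : Continuous g) (n : ℕ) (u : ℝ) :
    HasDerivAt (causalPrimitive g (n + 1)) (causalPrimitive g n u) u := by
  rw [causalPrimitive_succ]
  exact hasDerivAt_primitive (continuous_causalPrimitive hg n) u

lemma hasDerivAt_causalPrimitive_zero {g : ℝ → ℝ} (hg : Continuous g) {u : ℝ} (hu : 0 < u) :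
    HasDerivAt (causalPrimitive g 0) (g u) u := by
  refine (hasDerivAt_primitive hg u).congr_of_eventuallyEq ?_
  filter_upwards [lt_mem_nhds hu] with v hv
  simp [causalPrimitive, max_eq_left hv.le]

lemma causalPrimitive_of_nonpos (g : ℝ → ℝ) (n : ℕ) {u : ℝ} (hu : u ≤ 0) :
    causalPrimitive g n u = 0 := by
  induction n generalizing u with
  | zero => simp [causalPrimitive, primitive, max_eq_right hu]
  | succ n ih =>
    rw [causalPrimitive_succ, primitive, intervalIntegral.integral_congr (g := fun _ => 0)]
    · simp
    · intro s hs
      rw [uIcc_of_ge hu] at hs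
      exact ih hs.2

lemma causalPrimitive_of_nonneg (g : ℝ → ℝ) (n : ℕ) {u : ℝ} (hu : 0 ≤ u) :
    causalPrimitive g n u = primitive^[n + 1] g u := by
  induction n generalizing u with
  | zero => simp [causalPrimitive, max_eq_left hu]
  | succ n ih =>
    rw [causalPrimitive_succ, Function.iterate_succ_apply' (n := n + 1)]
    refine intervalIntegral.integral_congr fun s hs => ?_
    rw [uIcc_of_le hu] at hs
    exact ih hs.1

lemma integral_truncated_pow_mul {g : ℝ → ℝ} (hg : Continuous g) {n : ℕ} (hn : n ≠ 0)
    {t u : ℝ} (ht : 0 ≤ t) (hut : u ≤ t) :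
    ∫ s in (0 : ℝ)..t, max (u - s) 0 ^ n / (n.factorial : ℝ) * g s = causalPrimitive g n u := by
  have hint : ∀ a b : ℝ, IntervalIntegrable
      (fun s => max (u - s) 0 ^ n / (n.factorial : ℝ) * g s) volume a b :=
    fun a b => Continuous.intervalIntegrable (by fun_prop) _ _
  have hzero : ∀ a, u ≤ a → a ≤ t →
      ∫ s in a..t, max (u - s) 0 ^ n / (n.factorial : ℝ) * g s = 0 := by
    intro a hua hat
    rw [intervalIntegral.integral_congr (g := fun _ => 0)]
    · simp
    · intro s hs
      rw [uIcc_of_le hat] at hs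
      simp [max_eq_right (show u - s ≤ 0 by linarith [hs.1]), hn]
  rcases le_total u 0 with hu | hu
  · rw [hzero 0 hu ht, causalPrimitive_of_nonpos g n hu]
  · rw [← intervalIntegral.integral_add_adjacent_intervals (hint 0 u) (hint u t),
      hzero u le_rfl hut, add_zero, causalPrimitive_of_nonneg g n hu,
      ← integral_pow_mul_eq_iterate_primitive n hg u]
    refine intervalIntegral.integral_congr fun s hs => ?_
    rw [uIcc_of_le hu] at hs
    simp [max_eq_left (show 0 ≤ u - s by linarith [hs.2])]

lemma IsDelaySin.eq_sum_truncated_pow {τ ω : ℝ} (hτ : 0 < τ) {S : ℝ → ℝ}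
    (hS : IsDelaySin τ ω S) (N : ℕ) {v : ℝ} (hv : v < N * τ) :
    S v = ∑ j ∈ Finset.range (N + 1), (-1 : ℝ) ^ j * ω ^ (2 * j + 1) *
      (max (v - ((j : ℝ) - 1) * τ) 0 ^ (2 * j + 1) / ((2 * j + 1).factorial : ℝ)) := by
  rcases lt_or_ge v (-τ) with hneg | hge
  · rw [hS.1 v hneg, Finset.sum_eq_zero]
    intro j _
    have hj : (0 : ℝ) ≤ j * τ := by positivity
    rw [max_eq_right (by linarith)]
    simp
  · have hnn : 0 ≤ (v + τ) / τ := div_nonneg (by linarith) hτ.le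
    set k := ⌊(v + τ) / τ⌋₊
    have hk1 : (k : ℝ) * τ ≤ v + τ := (le_div_iff₀ hτ).1 (Nat.floor_le hnn)
    have hk2 : v + τ < ((k : ℝ) + 1) * τ := (div_lt_iff₀ hτ).1 (Nat.lt_floor_add_one _)
    have hkN : k < N + 1 := by
      have : (k : ℝ) < N + 1 := lt_of_mul_lt_mul_right (by linarith) hτ.le
      exact_mod_cast this
    rw [hS.2 k v (by linarith) (by linarith)]
    rw [← Finset.sum_subset (Finset.range_mono (show k + 1 ≤ N + 1 by omega))]
    · refine Finset.sum_congr rfl fun j hj => ?_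
      have hjk : (j : ℝ) ≤ k := by exact_mod_cast Nat.lt_succ_iff.1 (Finset.mem_range.1 hj)
      have := mul_le_mul_of_nonneg_right hjk hτ.le
      rw [max_eq_left (by linarith), mul_div_assoc]
    · intro j _ hj
      have hjk : (k : ℝ) + 1 ≤ j := by
        exact_mod_cast not_lt.1 (fun h => hj (Finset.mem_range.2 h))
      have := mul_le_mul_of_nonneg_right hjk hτ.le
      rw [max_eq_right (by linarith)]
      simp

lemma IsDelaySin.integral_mul_eq {τ ω : ℝ} (hτ : 0 < τ) {S : ℝ → ℝ} (hS : IsDelaySin τ ω S)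
    {g : ℝ → ℝ} (hg : Continuous g) (N : ℕ) {t : ℝ} (ht : 0 ≤ t) (htN : t < N * τ) :
    ∫ s in (0 : ℝ)..t, S (t - τ - s) * g s = ∑ j ∈ Finset.range (N + 1),
      (-1 : ℝ) ^ j * ω ^ (2 * j + 1) * causalPrimitive g (2 * j + 1) (t - j * τ) := by
  have hsum : ∀ s ∈ uIcc 0 t, S (t - τ - s) * g s = ∑ j ∈ Finset.range (N + 1),
      (-1 : ℝ) ^ j * ω ^ (2 * j + 1) *
        (max (t - j * τ - s) 0 ^ (2 * j + 1) / ((2 * j + 1).factorial : ℝ) * g s) := by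
    intro s hs
    rw [uIcc_of_le ht] at hs
    rw [hS.eq_sum_truncated_pow hτ N (by linarith [hs.1]), Finset.sum_mul]
    refine Finset.sum_congr rfl fun j _ => ?_
    rw [show t - τ - s - ((j : ℝ) - 1) * τ = t - j * τ - s by ring]
    ring
  rw [intervalIntegral.integral_congr hsum, intervalIntegral.integral_finsetSum
    fun j _ => Continuous.intervalIntegrable (by fun_prop) _ _]
  refine Finset.sum_congr rfl fun j _ => ?_
  have hj : (0 : ℝ) ≤ j * τ := by positivity
  rw [intervalIntegral.integral_const_mul,
    integral_truncated_pow_mul hg (by omega) ht (by linarith)]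

/-- **Variation-of-constants formula for the non-homogeneous pure-delay oscillator**
(Equation (3.3)): for continuous `f` on `[0, T]`, the function `x` vanishing on `[-τ, 0]`
and equal to `(1/ω) ∫_0^t sin_τ(ω, t-τ-s) f(s) ds` on `[0, T]` is continuously
differentiable on `[-τ, T]`, twice differentiable at every `t ∈ (0, T)`, and satisfies
`x''(t) + ω² x(t - τ) = f(t)` for all `t ∈ (0, T)`. -/
theorem delay_oscillator_duhamel (τ ω T : ℝ) (hτ : 0 < τ) (hω : 0 < ω) (hT : 0 < T)
    (ds : ℝ → ℝ) (hs : IsDelaySin τ ω ds)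
    (f : ℝ → ℝ) (hf : ContinuousOn f (Set.Icc 0 T))
    (x : ℝ → ℝ)
    (hx_hist : ∀ t ∈ Set.Icc (-τ) (0 : ℝ), x t = 0)
    (hx_rep : ∀ t ∈ Set.Icc (0 : ℝ) T, x t =
      1 / ω * ∫ s in (0 : ℝ)..t, ds (t - τ - s) * f s) :
    ∃ x' : ℝ → ℝ,
      (∀ t ∈ Set.Icc (-τ) T, HasDerivWithinAt x (x' t) (Set.Icc (-τ) T) t) ∧
      ContinuousOn x' (Set.Icc (-τ) T) ∧
      ∀ t ∈ Set.Ioo (0 : ℝ) T, HasDerivAt x' (f t - ω ^ 2 * x (t - τ)) t := by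
  obtain ⟨N, hN⟩ := exists_nat_gt (T / τ)
  have hTN : T < N * τ := (div_lt_iff₀ hτ).1 hN
  set g : ℝ → ℝ := IccExtend hT.le ((Icc 0 T).domRestrict f)
  have hg : Continuous g := (continuousOn_iff_continuous_domRestrict.1 hf).Icc_extend'
  have hgf : ∀ t ∈ Icc 0 T, g t = f t := fun t ht => IccExtend_of_mem _ _ ht
  have hx : ∀ t ∈ Icc (-τ) T, x t = ∑ j ∈ Finset.range (N + 1),
      (-1 : ℝ) ^ j * ω ^ (2 * j) * causalPrimitive g (2 * j + 1) (t - j * τ) := by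
    intro t ht
    rcases le_total t 0 with h0 | h0
    · rw [hx_hist t ⟨ht.1, h0⟩, Finset.sum_eq_zero]
      intro j _
      have hj : (0 : ℝ) ≤ j * τ := by positivity
      rw [causalPrimitive_of_nonpos g _ (by linarith), mul_zero]
    · have hcongr : ∫ s in (0 : ℝ)..t, ds (t - τ - s) * f s =
          ∫ s in (0 : ℝ)..t, ds (t - τ - s) * g s := by
        refine intervalIntegral.integral_congr fun s hs => ?_
        rw [uIcc_of_le h0] at hs
        simp only [hgf s ⟨hs.1, hs.2.trans ht.2⟩]
      rw [hx_rep t ⟨h0, ht.2⟩, hcongr,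
        hs.integral_mul_eq hτ hg N h0 (ht.2.trans_lt hTN), Finset.mul_sum]
      refine Finset.sum_congr rfl fun j _ => ?_
      field_simp
      ring
  refine ⟨fun t => ∑ j ∈ Finset.range (N + 1),
    (-1 : ℝ) ^ j * ω ^ (2 * j) * causalPrimitive g (2 * j) (t - j * τ), ?_, ?_, ?_⟩
  · intro t ht
    refine HasDerivWithinAt.congr (HasDerivAt.hasDerivWithinAt ?_) hx (hx t ht)
    exact HasDerivAt.fun_sum fun j _ =>
      ((hasDerivAt_causalPrimitive_succ hg (2 * j) _).comp_sub_const t _).const_mul _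
  · refine Continuous.continuousOn (continuous_finsetSum _ fun j _ => ?_)
    have := continuous_causalPrimitive hg (2 * j)
    fun_prop
  · intro t ht
    have hlast : causalPrimitive g (2 * N + 1) (t - τ - N * τ) = 0 :=
      causalPrimitive_of_nonpos g _ (by linarith [ht.2])
    rw [hx (t - τ) ⟨by linarith [ht.1], by linarith [ht.2]⟩, Finset.sum_range_succ, hlast,
      mul_zero, add_zero, ← hgf t ⟨ht.1.le, ht.2.le⟩]
    simp only [Finset.sum_range_succ' _ N]
    have hzero : HasDerivAt (fun t : ℝ => (-1 : ℝ) ^ 0 * ω ^ (2 * 0) *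
        causalPrimitive g (2 * 0) (t - (0 : ℕ) * τ)) (g t) t := by
      simpa using hasDerivAt_causalPrimitive_zero hg ht.1
    have hrest : HasDerivAt (fun t : ℝ => ∑ j ∈ Finset.range N, (-1 : ℝ) ^ (j + 1) *
        ω ^ (2 * (j + 1)) * causalPrimitive g (2 * (j + 1)) (t - (j + 1 : ℕ) * τ))
        (∑ j ∈ Finset.range N, (-1 : ℝ) ^ (j + 1) * ω ^ (2 * (j + 1)) *
          causalPrimitive g (2 * j + 1) (t - (j + 1 : ℕ) * τ)) t :=
      HasDerivAt.fun_sum fun j _ =>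
        ((hasDerivAt_causalPrimitive_succ hg (2 * j + 1) _).comp_sub_const t _).const_mul _
    refine (hrest.fun_add hzero).congr_deriv ?_
    rw [sub_eq_neg_add (g t), Finset.mul_sum, ← Finset.sum_neg_distrib]
    congr 1
    refine Finset.sum_congr rfl fun j _ => ?_
    rw [show t - τ - j * τ = t - (j + 1 : ℕ) * τ by push_cast; ring]
    ring
end

section
/- Let l, a, τ, T > 0 and c ∈ ℝ with c < (πa/l)², set ω_n = √((πna/l)² − c) for each integer n ≥ 1 and m = ⌈T/τ⌉. Let ψ_n : [-τ, 0] → ℝ be continuous functions such that for some α > 0, lim_{n→∞} (max_{s ∈ [-τ,0]} |ψ_n(s)|) n^{2m+3+α} = 0. Then the series S₂(t, x) = Σ_{n=1}^{∞} ((1/ω_n) ∫_{-τ}^{0} sin_τ(ω_n, t - τ - s) ψ_n(s) ds) sin(πnx/l) converges absolutely and uniformly on [0, T] × [0, l]; moreover, the series obtained by term-wise application of any partial derivative in t and x of total order at most 2 also converge absolutely and uniformly on compact subsets of (0, T) × [0, l], the sum S₂ is twice continuously differentiable on (0, T) × (0, l), and its partial derivatives of order at most 2 are given by term-wise differentiation.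 -/
open Real Set Filter Topology MeasureTheory

/-- The partial derivative `∂_t^i ∂_x^j F` of a function `F` of two real variables. -/
noncomputable def pd (i j : ℕ) (F : ℝ → ℝ → ℝ) (t x : ℝ) : ℝ :=
  iteratedDeriv i (fun t' => iteratedDeriv j (fun x' => F t' x') x) t

/-- The iterated derivatives of a `C^N` function on an open set are differentiable there. -/
theorem hasDerivAt_iteratedDeriv_of_contDiffOn {N i : ℕ} {I : Set ℝ} (hI : IsOpen I) {f : ℝ → ℝ}
    (hf : ContDiffOn ℝ N f I) (hi : i < N) {t : ℝ} (ht : t ∈ I) :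
    HasDerivAt (iteratedDeriv i f) (iteratedDeriv (i + 1) f t) t := by
  rw [iteratedDeriv_succ]
  have hd := ((hf.differentiableOn_iteratedDerivWithin (m := i) (by exact_mod_cast hi)
    hI.uniqueDiffOn).congr fun s hs => (iteratedDerivWithin_of_isOpen hI hs).symm)
  exact (hd.differentiableAt (hI.mem_nhds ht)).hasDerivAt

/-- Term-wise differentiation of a series of products `g n t * h n x`, in both variables. -/
theorem hasFDerivAt_tsum_iteratedDeriv_mul {N : ℕ} {I : Set ℝ} (hI : IsOpen I)
    (hI' : IsPreconnected I) {g h : ℕ → ℝ → ℝ} (hg : ∀ n, ContDiffOn ℝ N (g n) I)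
    (hh : ∀ n, ContDiff ℝ N (h n)) {M : ℕ → ℝ} (hM : Summable M)
    (hb : ∀ i q, i + q ≤ N → ∀ n, ∀ t ∈ I, ∀ x,
      |iteratedDeriv i (g n) t * iteratedDeriv q (h n) x| ≤ M n)
    {i q : ℕ} (hiq : i + q < N) {t : ℝ} (ht : t ∈ I) (x : ℝ) :
    HasFDerivAt
      (fun p : ℝ × ℝ => ∑' n, iteratedDeriv i (g n) p.1 * iteratedDeriv q (h n) p.2)
      ((∑' n, iteratedDeriv (i + 1) (g n) t * iteratedDeriv q (h n) x) •
          ContinuousLinearMap.fst ℝ ℝ ℝ +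
        (∑' n, iteratedDeriv i (g n) t * iteratedDeriv (q + 1) (h n) x) •
          ContinuousLinearMap.snd ℝ ℝ ℝ) (t, x) := by
  have hsum : ∀ i q, i + q ≤ N → ∀ t ∈ I, ∀ x,
      Summable fun n => iteratedDeriv i (g n) t * iteratedDeriv q (h n) x :=
    fun i q hiq t ht x => hM.of_norm_bounded fun n => hb i q hiq n t ht x
  have hterm : ∀ n, ∀ p ∈ I ×ˢ (univ : Set ℝ),
      HasFDerivAt (fun p : ℝ × ℝ => iteratedDeriv i (g n) p.1 * iteratedDeriv q (h n) p.2)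
        ((iteratedDeriv (i + 1) (g n) p.1 * iteratedDeriv q (h n) p.2) •
            ContinuousLinearMap.fst ℝ ℝ ℝ +
          (iteratedDeriv i (g n) p.1 * iteratedDeriv (q + 1) (h n) p.2) •
            ContinuousLinearMap.snd ℝ ℝ ℝ) p := by
    intro n p hp
    have h1 : HasDerivAt (iteratedDeriv i (g n)) (iteratedDeriv (i + 1) (g n) p.1) p.1 :=
      hasDerivAt_iteratedDeriv_of_contDiffOn hI (hg n) (by omega) hp.1
    have h2 : HasDerivAt (iteratedDeriv q (h n)) (iteratedDeriv (q + 1) (h n) p.2) p.2 :=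
      hasDerivAt_iteratedDeriv_of_contDiffOn isOpen_univ (hh n).contDiffOn (by omega) (mem_univ _)
    refine ((h1.comp_hasFDerivAt p (hasFDerivAt_fst (𝕜 := ℝ))).fun_mul
      (h2.comp_hasFDerivAt p (hasFDerivAt_snd (𝕜 := ℝ)))).congr_fderiv ?_
    ext <;> simp [mul_comm]
  have hnorm : ∀ n, ∀ p ∈ I ×ˢ (univ : Set ℝ),
      ‖(iteratedDeriv (i + 1) (g n) p.1 * iteratedDeriv q (h n) p.2) •
          ContinuousLinearMap.fst ℝ ℝ ℝ +
        (iteratedDeriv i (g n) p.1 * iteratedDeriv (q + 1) (h n) p.2) •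
          ContinuousLinearMap.snd ℝ ℝ ℝ‖ ≤ M n + M n := by
    intro n p hp
    refine (norm_add_le _ _).trans (add_le_add ?_ ?_) <;> rw [norm_smul]
    · exact (mul_le_of_le_one_right (norm_nonneg _)
        (ContinuousLinearMap.norm_fst_le ℝ ℝ ℝ)).trans (hb _ _ (by omega) n _ hp.1 _)
    · exact (mul_le_of_le_one_right (norm_nonneg _)
        (ContinuousLinearMap.norm_snd_le ℝ ℝ ℝ)).trans (hb _ _ (by omega) n _ hp.1 _)
  have key := hasFDerivAt_tsum_of_isPreconnected (hM.add hM) (hI.prod isOpen_univ)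
    (hI'.prod isPreconnected_univ) hterm hnorm (x₀ := (t, x)) ⟨ht, mem_univ _⟩
    (hsum i q hiq.le t ht x) (x := (t, x)) ⟨ht, mem_univ _⟩
  have s1 := hsum (i + 1) q (by omega) t ht x
  have s2 := hsum i (q + 1) (by omega) t ht x
  refine key.congr_fderiv ?_
  rw [(s1.smul_const _).tsum_add (s2.smul_const _), s1.tsum_smul_const, s2.tsum_smul_const]

/-- A series of products `g n t * h n x` whose term-wise derivatives of order at most `N` are
dominated by a summable sequence is of class `C^N`. -/
theorem contDiffOn_tsum_mul {N : ℕ} {I : Set ℝ} (hI : IsOpen I)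
    (hI' : IsPreconnected I) {g h : ℕ → ℝ → ℝ} (hg : ∀ n, ContDiffOn ℝ N (g n) I)
    (hh : ∀ n, ContDiff ℝ N (h n)) {M : ℕ → ℝ} (hM : Summable M)
    (hb : ∀ i q, i + q ≤ N → ∀ n, ∀ t ∈ I, ∀ x,
      |iteratedDeriv i (g n) t * iteratedDeriv q (h n) x| ≤ M n) :
    ContDiffOn ℝ N (fun p : ℝ × ℝ => ∑' n, g n p.1 * h n p.2) (I ×ˢ univ) := by
  suffices H : ∀ k i q : ℕ, i + q + k ≤ N → ContDiffOn ℝ k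
      (fun p : ℝ × ℝ => ∑' n, iteratedDeriv i (g n) p.1 * iteratedDeriv q (h n) p.2)
      (I ×ˢ univ) by simpa using H N 0 0 (by simp)
  intro k
  induction k with
  | zero =>
    intro i q hiq
    rw [Nat.cast_zero, contDiffOn_zero]
    refine continuousOn_tsum (fun n => ?_) hM fun n p hp => hb i q (by omega) n _ hp.1 _
    refine ContinuousOn.mul ?_ ?_
    · have : ContinuousOn (iteratedDeriv i (g n)) I := by
        refine (((hg n).continuousOn_iteratedDerivWithin
          (by exact_mod_cast (by omega : i ≤ N)) hI.uniqueDiffOn)).congr ?_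
        exact (iteratedDerivWithin_of_isOpen hI).symm
      exact this.comp continuousOn_fst fun p hp => hp.1
    · exact (((hh n).continuous_iteratedDeriv q
        (by exact_mod_cast (by omega : q ≤ N))).comp continuous_snd).continuousOn
  | succ k ih =>
    intro i q hiq
    have hd : ∀ p ∈ I ×ˢ (univ : Set ℝ), _ := fun p hp =>
      hasFDerivAt_tsum_iteratedDeriv_mul hI hI' hg hh hM hb (i := i) (q := q) (by omega) hp.1 p.2
    rw [Nat.cast_succ, contDiffOn_succ_iff_fderiv_of_isOpen (hI.prod isOpen_univ)]
    refine ⟨fun p hp => (hd p hp).differentiableAt.differentiableWithinAt, by simp, ?_⟩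
    refine ContDiffOn.congr ?_ fun p hp => (hd p hp).fderiv
    exact ((ih (i + 1) q (by omega)).smul contDiffOn_const).add
      ((ih i (q + 1) (by omega)).smul contDiffOn_const)

/-- The partial derivatives of a product of functions of one variable. -/
theorem pd_mul (i j : ℕ) (g h : ℝ → ℝ) (t x : ℝ) :
    pd i j (fun t x => g t * h x) t x = iteratedDeriv i g t * iteratedDeriv j h x := by
  simp only [pd, iteratedDeriv_const_mul_field, iteratedDeriv_mul_const_field]

/-- Partial derivatives of a series of products are computed term by term. -/
theorem pd_tsum_mul {N : ℕ} {I : Set ℝ} (hI : IsOpen I)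
    (hI' : IsPreconnected I) {g h : ℕ → ℝ → ℝ} (hg : ∀ n, ContDiffOn ℝ N (g n) I)
    (hh : ∀ n, ContDiff ℝ N (h n)) {M : ℕ → ℝ} (hM : Summable M)
    (hb : ∀ i q, i + q ≤ N → ∀ n, ∀ t ∈ I, ∀ x,
      |iteratedDeriv i (g n) t * iteratedDeriv q (h n) x| ≤ M n)
    {i j : ℕ} (hij : i + j ≤ N) {t : ℝ} (ht : t ∈ I) (x : ℝ) :
    pd i j (fun t x => ∑' n, g n t * h n x) t x =
      ∑' n, pd i j (fun t x => g n t * h n x) t x := by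
  simp only [pd_mul]
  have hx : ∀ j ≤ N, ∀ t ∈ I, ∀ x, iteratedDeriv j (fun x => ∑' n, g n t * h n x) x =
      ∑' n, g n t * iteratedDeriv j (h n) x := by
    intro j
    induction j with
    | zero => intros; simp
    | succ j ih =>
      intro hj t ht x
      rw [iteratedDeriv_succ, funext (ih (by omega) t ht)]
      have := (hasFDerivAt_tsum_iteratedDeriv_mul hI hI' hg hh hM hb (i := 0) (q := j)
        (by omega) ht x).comp_hasDerivAt x ((hasDerivAt_const x t).prodMk (hasDerivAt_id x))
      simpa [Function.comp_def] using this.deriv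
  have ht' : ∀ i, i + j ≤ N → ∀ t ∈ I,
      iteratedDeriv i (fun t => iteratedDeriv j (fun x => ∑' n, g n t * h n x) x) t =
      ∑' n, iteratedDeriv i (g n) t * iteratedDeriv j (h n) x := by
    intro i
    induction i with
    | zero => intro _ t ht; simpa using hx j (by omega) t ht x
    | succ i ih =>
      intro hi t ht
      have hev : iteratedDeriv i (fun t => iteratedDeriv j (fun x => ∑' n, g n t * h n x) x)
          =ᶠ[𝓝 t] fun t => ∑' n, iteratedDeriv i (g n) t * iteratedDeriv j (h n) x := by
        filter_upwards [hI.mem_nhds ht] with s hs using ih (by omega) s hs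
      rw [iteratedDeriv_succ, hev.deriv_eq]
      have := (hasFDerivAt_tsum_iteratedDeriv_mul hI hI' hg hh hM hb (i := i) (q := j)
        (by omega) ht x).comp_hasDerivAt t ((hasDerivAt_id t).prodMk (hasDerivAt_const t x))
      simpa [Function.comp_def] using this.deriv
  exact ht' i hij t ht

/-- Differentiation under the integral sign in a convolution over a compact interval. -/
theorem hasDerivAt_integral_comp_sub_mul {f f' φ : ℝ → ℝ} {a b : ℝ} (hab : a ≤ b)
    (hf : ∀ y, HasDerivAt f (f' y) y) (hf' : Continuous f') (hφ : ContinuousOn φ (Icc a b))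
    (t : ℝ) :
    HasDerivAt (fun t => ∫ s in a..b, f (t - s) * φ s) (∫ s in a..b, f' (t - s) * φ s) t := by
  have hfc : Continuous f := continuous_iff_continuousAt.2 fun y => (hf y).continuousAt
  have hφ' : ContinuousOn φ (uIcc a b) := by rwa [uIcc_of_le hab]
  have hint : ∀ g : ℝ → ℝ, Continuous g → ∀ t,
      IntervalIntegrable (fun s => g (t - s) * φ s) volume a b := fun g hg t =>
    ContinuousOn.intervalIntegrable
      ((hg.comp (continuous_const.sub continuous_id)).continuousOn.mul hφ')
  obtain ⟨C, hC⟩ := (isCompact_Icc (a := t - 1 - b) (b := t + 1 - a)).exists_bound_of_continuousOn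
    hf'.continuousOn
  refine (intervalIntegral.hasDerivAt_integral_of_dominated_loc_of_deriv_le
    (F := fun t s => f (t - s) * φ s) (F' := fun t s => f' (t - s) * φ s)
    (bound := fun s => C * ‖φ s‖) (Ioo_mem_nhds (sub_one_lt t) (lt_add_one t))
    (Eventually.of_forall fun t => ?_) (hint f hfc t) ?_ ?_ ?_ ?_).2
  · exact (intervalIntegrable_iff.1 (hint f hfc t)).aestronglyMeasurable
  · exact (intervalIntegrable_iff.1 (hint f' hf' t)).aestronglyMeasurable
  · refine Eventually.of_forall fun s hs y hy => ?_
    rw [uIoc_of_le hab] at hs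
    rw [norm_mul]
    gcongr
    exact hC _ ⟨by linarith [hy.1, hs.2], by linarith [hy.2, hs.1]⟩
  · exact ContinuousOn.intervalIntegrable (continuousOn_const.mul hφ'.norm)
  · refine Eventually.of_forall fun s _ y _ => ?_
    have := (hf (y - s)).comp y ((hasDerivAt_id y).sub_const s)
    simpa using this.mul_const (φ s)

/-- The iterated derivatives of a convolution over a compact interval. -/
theorem iteratedDeriv_integral_comp_sub_mul {N : ℕ} {f φ : ℝ → ℝ} {a b : ℝ} (hab : a ≤ b)
    (hf : ContDiff ℝ N f) (hφ : ContinuousOn φ (Icc a b)) {i : ℕ} (hi : i ≤ N) :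
    iteratedDeriv i (fun t => ∫ s in a..b, f (t - s) * φ s) =
      fun t => ∫ s in a..b, iteratedDeriv i f (t - s) * φ s := by
  induction i with
  | zero => simp
  | succ i ih =>
    rw [iteratedDeriv_succ, ih (by omega)]
    ext t
    refine (hasDerivAt_integral_comp_sub_mul hab (fun y => ?_) (hf.continuous_iteratedDeriv _
      (by exact_mod_cast hi)) hφ t).deriv
    exact hasDerivAt_iteratedDeriv_of_contDiffOn isOpen_univ hf.contDiffOn hi (mem_univ y)

/-- A convolution of a `C^N` function over a compact interval is of class `C^N`. -/
theorem contDiff_integral_comp_sub_mul {N : ℕ} {f φ : ℝ → ℝ} {a b : ℝ} (hab : a ≤ b)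
    (hf : ContDiff ℝ N f) (hφ : ContinuousOn φ (Icc a b)) :
    ContDiff ℝ N (fun t => ∫ s in a..b, f (t - s) * φ s) := by
  have hcont : ∀ g : ℝ → ℝ, Continuous g → Continuous fun t => ∫ s in a..b, g (t - s) * φ s := by
    intro g hg
    have heq : (fun t => ∫ s in a..b, g (t - s) * φ s) =
        fun t => ∫ s in a..b, g (t - s) * IccExtend hab (domRestrict (Icc a b) φ) s := by
      ext t
      refine intervalIntegral.integral_congr fun s hs => ?_
      rw [uIcc_of_le hab] at hs
      simp [IccExtend_of_mem hab _ hs]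
    rw [heq]
    have : Continuous (IccExtend hab (domRestrict (Icc a b) φ)) :=
      (continuousOn_iff_continuous_domRestrict.1 hφ).Icc_extend'
    refine intervalIntegral.continuous_parametric_intervalIntegral_of_continuous' ?_ a b
    exact (hg.comp (continuous_fst.sub continuous_snd)).mul (this.comp continuous_snd)
  refine contDiff_nat_iff_iteratedDeriv.2 ⟨fun i hi => ?_, fun i hi t => ?_⟩
  · rw [iteratedDeriv_integral_comp_sub_mul hab hf hφ hi]
    exact hcont _ (hf.continuous_iteratedDeriv i (by exact_mod_cast hi))
  · rw [iteratedDeriv_integral_comp_sub_mul hab hf hφ hi.le]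
    refine (hasDerivAt_integral_comp_sub_mul hab (fun y => ?_) (hf.continuous_iteratedDeriv (i + 1)
      (by exact_mod_cast hi)) hφ t).differentiableAt
    exact hasDerivAt_iteratedDeriv_of_contDiffOn isOpen_univ hf.contDiffOn hi (mem_univ y)

/-- The truncated power `y ↦ (y₊)^(k+1)` is of class `C^k`. -/
theorem contDiff_max_zero_pow (k : ℕ) : ContDiff ℝ k fun y : ℝ => max y 0 ^ (k + 1) := by
  have hc : ∀ k : ℕ, Continuous fun y : ℝ => max y 0 ^ (k + 1) := fun k => by fun_prop
  induction k with
  | zero => simpa using hc 0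
  | succ k ih =>
    have hd : ∀ y : ℝ, HasDerivAt (fun y : ℝ => max y 0 ^ (k + 2))
        (((k + 2 : ℕ) : ℝ) * max y 0 ^ (k + 1)) y := by
      refine fun y => hasDerivAt_of_hasDerivAt_of_ne' (x := 0) (fun y hy => ?_)
        (hc (k + 1)).continuousAt (continuous_const.mul (hc k)).continuousAt y
      rcases hy.lt_or_gt with hy | hy
      · have hev : (fun y : ℝ => max y 0 ^ (k + 2)) =ᶠ[𝓝 y] fun _ => 0 := by
          filter_upwards [Iio_mem_nhds hy] with z hz
          simp [max_eq_right (mem_Iio.1 hz).le]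
        simpa [max_eq_right hy.le] using (hasDerivAt_const y (0 : ℝ)).congr_of_eventuallyEq hev
      · have hev : (fun y : ℝ => max y 0 ^ (k + 2)) =ᶠ[𝓝 y] fun y => y ^ (k + 2) := by
          filter_upwards [Ioi_mem_nhds hy] with z hz
          simp [max_eq_left (mem_Ioi.1 hz).le]
        simpa [max_eq_left hy.le] using (hasDerivAt_pow (k + 2) y).congr_of_eventuallyEq hev
    rw [Nat.cast_succ, contDiff_succ_iff_deriv]
    refine ⟨fun y => (hd y).differentiableAt, by simp, ?_⟩
    rw [show deriv (fun y : ℝ => max y 0 ^ (k + 1 + 1)) = _ from funext fun y => (hd y).deriv]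
    exact contDiff_const.mul ih

/-- The delay sine as a sum of truncated powers with a fixed number of terms. -/
theorem IsDelaySin.eq_sum_max {τ ω : ℝ} {S : ℝ → ℝ} (hS : IsDelaySin τ ω S) (hτ : 0 < τ) {r : ℝ}
    (hr : -τ ≤ r) {m : ℕ} (hm : r ≤ m * τ) :
    S r = ∑ j ∈ Finset.range (m + 1), (-1 : ℝ) ^ j * ω ^ (2 * j + 1) *
      max (r - ((j : ℝ) - 1) * τ) 0 ^ (2 * j + 1) / ((2 * j + 1).factorial : ℝ) := by
  set F : ℕ → ℝ := fun j => (-1 : ℝ) ^ j * ω ^ (2 * j + 1) *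
      max (r - ((j : ℝ) - 1) * τ) 0 ^ (2 * j + 1) / ((2 * j + 1).factorial : ℝ) with hF
  have hF0 : ∀ j : ℕ, r ≤ ((j : ℝ) - 1) * τ → F j = 0 := fun j hj => by
    simp [hF, max_eq_right (sub_nonpos.2 hj)]
  have hpos : 0 ≤ r / τ + 1 := by
    have : -1 ≤ r / τ := by rw [le_div_iff₀ hτ]; linarith
    linarith
  obtain ⟨k, hk1, hk2⟩ : ∃ k : ℕ, ((k : ℝ) - 1) * τ ≤ r ∧ r < (k : ℝ) * τ := by
    refine ⟨⌊r / τ + 1⌋₊, ?_, ?_⟩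
    · rw [← le_div_iff₀ hτ]
      linarith [Nat.floor_le hpos]
    · rw [← div_lt_iff₀ hτ]
      linarith [Nat.lt_floor_add_one (r / τ + 1)]
  have hkm : k ≤ m + 1 := by
    have : ((k : ℝ) - 1) ≤ m := le_of_mul_le_mul_right (hk1.trans hm) hτ
    exact_mod_cast (by linarith : (k : ℝ) ≤ m + 1)
  have hSk : S r = ∑ j ∈ Finset.range (k + 1), F j := by
    rw [hS.2 k r hk1 hk2]
    refine Finset.sum_congr rfl fun j hj => ?_
    have hjk : (j : ℝ) ≤ k := by exact_mod_cast Finset.mem_range_succ_iff.1 hj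
    have : ((j : ℝ) - 1) * τ ≤ r := le_trans (by gcongr) hk1
    simp only [hF, max_eq_left (sub_nonneg.2 this)]
  rw [hSk]
  trans ∑ j ∈ Finset.range (m + 2), F j
  · refine Finset.sum_subset (Finset.range_subset_range.2 (by omega)) fun j _ hj => hF0 j ?_
    have hjk : (k : ℝ) ≤ (j : ℝ) - 1 := by
      rw [le_sub_iff_add_le]
      exact_mod_cast not_lt.1 (fun h => hj (Finset.mem_range.2 h))
    exact hk2.le.trans (by gcongr)
  · rw [Finset.sum_range_succ, hF0 (m + 1) (by push_cast; linarith), add_zero]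

/-- The `j`-th term of `ω⁻¹ sin_τ(ω, y - τ)`, divided by `ω ^ (2 * j)`; the truncation is omitted
for `j = 0`, which makes the function `C²` and does not change its values for `y ≥ 0`. -/
noncomputable def delayKernel (τ : ℝ) (j : ℕ) (y : ℝ) : ℝ :=
  (-1 : ℝ) ^ j / ((2 * j + 1).factorial : ℝ) *
    if j = 0 then y else max (y - j * τ) 0 ^ (2 * j + 1)

/-- The delay kernels are of class `C²`. -/
theorem contDiff_delayKernel (τ : ℝ) (j : ℕ) : ContDiff ℝ 2 (delayKernel τ j) := by
  unfold delayKernel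
  refine contDiff_const.mul ?_
  rcases eq_or_ne j 0 with rfl | hj
  · simpa using contDiff_fun_id
  · simp only [hj, if_false]
    have := (contDiff_max_zero_pow (2 * j)).of_le
      (show (2 : WithTop ℕ∞) ≤ ((2 * j : ℕ) : WithTop ℕ∞) by
        exact_mod_cast (by omega : 2 ≤ 2 * j))
    exact this.comp (contDiff_id.sub contDiff_const)

/-- The delay sine in terms of the delay kernels. -/
theorem IsDelaySin.eq_sum_delayKernel {τ ω : ℝ} {S : ℝ → ℝ} (hS : IsDelaySin τ ω S) (hτ : 0 < τ)
    {y : ℝ} (hy : 0 ≤ y) {m : ℕ} (hm : y ≤ (m + 1) * τ) :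
    S (y - τ) = ω * ∑ j ∈ Finset.range (m + 1), ω ^ (2 * j) * delayKernel τ j y := by
  rw [hS.eq_sum_max hτ (r := y - τ) (by linarith) (m := m) (by linarith), Finset.mul_sum]
  refine Finset.sum_congr rfl fun j _ => ?_
  have h1 : y - τ - ((j : ℝ) - 1) * τ = y - j * τ := by ring
  rw [h1, delayKernel]
  rcases eq_or_ne j 0 with rfl | hj
  · simp [hy]
  · simp only [hj, if_false]
    ring

/-- Uniform bounds, on a compact interval, for the derivatives of the combinations of delay kernels
which represent the delay sine. -/
theorem exists_bound_iteratedDeriv_sum_delayKernel (τ : ℝ) (m : ℕ) (L : ℝ) :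
    ∃ C, 0 ≤ C ∧ ∀ ω W : ℝ, ω ^ 2 ≤ W → 1 ≤ W → ∀ i ≤ 2, ∀ y ∈ Icc 0 L,
      |iteratedDeriv i (fun y => ∑ j ∈ Finset.range (m + 1), ω ^ (2 * j) * delayKernel τ j y) y| ≤
        C * W ^ m := by
  have hex : ∀ i j : ℕ, ∃ C, 0 ≤ C ∧ (i ≤ 2 → ∀ y ∈ Icc 0 L,
      |iteratedDeriv i (delayKernel τ j) y| ≤ C) := by
    intro i j
    by_cases hi : i ≤ 2
    · obtain ⟨C, hC⟩ := (isCompact_Icc (a := 0) (b := L)).exists_bound_of_continuousOn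
        ((contDiff_delayKernel τ j).continuous_iteratedDeriv i (by exact_mod_cast hi)).continuousOn
      exact ⟨max C 0, le_max_right _ _, fun _ y hy => (hC y hy).trans (le_max_left _ _)⟩
    · exact ⟨0, le_rfl, fun h => absurd h hi⟩
  choose C hC0 hC using hex
  refine ⟨∑ j ∈ Finset.range (m + 1), ∑ i ∈ Finset.range 3, C i j,
    Finset.sum_nonneg fun j _ => Finset.sum_nonneg fun i _ => hC0 i j, ?_⟩
  intro ω W hW hW1 i hi y hy
  rw [iteratedDeriv_fun_sum fun j _ => (contDiff_const.mul
    ((contDiff_delayKernel τ j).of_le (by exact_mod_cast hi))).contDiffAt, Finset.sum_mul]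
  refine (Finset.abs_sum_le_sum_abs _ _).trans (Finset.sum_le_sum fun j hj => ?_)
  rw [iteratedDeriv_const_mul_field, abs_mul, pow_mul,
    abs_of_nonneg (pow_nonneg (sq_nonneg ω) j), mul_comm]
  refine mul_le_mul ((hC i j hi y hy).trans ?_) ?_ (by positivity)
    (Finset.sum_nonneg fun i _ => hC0 i j)
  · exact Finset.single_le_sum (f := fun i => C i j) (fun i _ => hC0 i j)
      (Finset.mem_range.2 (by omega))
  · exact (pow_le_pow_left₀ (sq_nonneg ω) hW j).trans
      (pow_le_pow_right₀ hW1 (Finset.mem_range_succ_iff.1 hj))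

/-- Regularity and bounds for the time-dependent factors of the second Fourier series. -/
theorem exists_bound_delaySin_coefficient {τ T : ℝ} (hτ : 0 < τ) {m : ℕ} (hm : T ≤ m * τ) :
    ∃ C, 0 ≤ C ∧ ∀ (ω W P : ℝ) (S φ : ℝ → ℝ), 0 < ω → ω ^ 2 ≤ W → 1 ≤ W → IsDelaySin τ ω S →
      ContinuousOn φ (Icc (-τ) 0) → (∀ s ∈ Icc (-τ) 0, |φ s| ≤ P) →
      ContDiffOn ℝ 2 (fun t => 1 / ω * ∫ s in (-τ)..0, S (t - τ - s) * φ s) (Ioo 0 T) ∧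
      (∀ i ≤ 2, ∀ t ∈ Ioo 0 T,
        |iteratedDeriv i (fun t => 1 / ω * ∫ s in (-τ)..0, S (t - τ - s) * φ s) t| ≤
          C * W ^ m * P) ∧
      ∀ t ∈ Icc 0 T, |1 / ω * ∫ s in (-τ)..0, S (t - τ - s) * φ s| ≤ C * W ^ m * P := by
  obtain ⟨C, hC0, hC⟩ := exists_bound_iteratedDeriv_sum_delayKernel τ m (T + τ)
  refine ⟨C * τ, by positivity, fun ω W P S φ hω hW hW1 hS hφ hP => ?_⟩
  set Q : ℝ → ℝ := fun y => ∑ j ∈ Finset.range (m + 1), ω ^ (2 * j) * delayKernel τ j y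
  have hτ' : -τ ≤ 0 := by linarith
  have hQ2 : ContDiff ℝ (2 : ℕ) Q :=
    ContDiff.sum fun j _ => contDiff_const.mul (contDiff_delayKernel τ j)
  have heq : EqOn (fun t => 1 / ω * ∫ s in (-τ)..0, S (t - τ - s) * φ s)
      (fun t => ∫ s in (-τ)..0, Q (t - s) * φ s) (Icc 0 T) := by
    intro t ht
    beta_reduce
    rw [← intervalIntegral.integral_const_mul]
    refine intervalIntegral.integral_congr fun s hs => ?_
    rw [uIcc_of_le hτ'] at hs
    rw [sub_right_comm, hS.eq_sum_delayKernel hτ (m := m) (by linarith [ht.1, hs.2])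
      (by linarith [ht.2, hs.1])]
    rw [← mul_assoc, ← mul_assoc, one_div_mul_cancel hω.ne', one_mul]
  have hbound : ∀ i ≤ 2, ∀ t ∈ Icc 0 T,
      |iteratedDeriv i (fun t => ∫ s in (-τ)..0, Q (t - s) * φ s) t| ≤ C * τ * W ^ m * P := by
    intro i hi t ht
    rw [iteratedDeriv_integral_comp_sub_mul hτ' hQ2 hφ hi]
    have := intervalIntegral.norm_integral_le_of_norm_le_const (a := -τ) (b := 0)
      (f := fun s => iteratedDeriv i Q (t - s) * φ s) (C := C * W ^ m * P) fun s hs => by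
        rw [uIoc_of_le hτ'] at hs
        rw [norm_mul]
        exact mul_le_mul (hC ω W hW hW1 i hi _ ⟨by linarith [ht.1, hs.2], by linarith [ht.2, hs.1]⟩)
          (hP s (Ioc_subset_Icc_self hs)) (norm_nonneg _) (by positivity)
    rw [sub_neg_eq_add, zero_add, abs_of_pos hτ] at this
    calc _ ≤ C * W ^ m * P * τ := this
      _ = _ := by ring
  refine ⟨?_, fun i hi t ht => ?_, fun t ht => ?_⟩
  · exact (contDiff_integral_comp_sub_mul hτ' hQ2 hφ).contDiffOn.congr
      (heq.mono Ioo_subset_Icc_self)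
  · rw [((heq.mono Ioo_subset_Icc_self).eventuallyEq_of_mem
      (isOpen_Ioo.mem_nhds ht)).iteratedDeriv_eq i]
    exact hbound i hi t (Ioo_subset_Icc_self ht)
  · have := hbound 0 (by norm_num) t ht
    rwa [iteratedDeriv_zero, show ∫ s in (-τ)..0, Q (t - s) * φ s = _ from (heq ht).symm] at this

/-- The derivatives of order at most `N` of `x ↦ sin (κ x)` are bounded by `(1 + κ) ^ N`. -/
theorem abs_iteratedDeriv_sin_const_mul_le {κ : ℝ} (hκ : 0 ≤ κ) {q N : ℕ} (hq : q ≤ N) (x : ℝ) :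
    |iteratedDeriv q (fun x => Real.sin (κ * x)) x| ≤ (1 + κ) ^ N := by
  rw [iteratedDeriv_comp_const_mul Real.contDiff_sin, abs_mul, abs_of_nonneg (by positivity)]
  calc κ ^ q * |iteratedDeriv q Real.sin (κ * x)| ≤ κ ^ q * 1 := by
        gcongr; exact Real.abs_iteratedDeriv_sin_le_one q _
    _ ≤ (1 + κ) ^ q := by rw [mul_one]; gcongr; linarith
    _ ≤ (1 + κ) ^ N := pow_le_pow_right₀ (by linarith) hq

/-- A series whose terms are dominated on a set by a summable sequence converges absolutely and
uniformly there. -/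
theorem summable_abs_and_tendstoUniformlyOn {β : Type*} {f : ℕ → β → ℝ} {M : ℕ → ℝ}
    (hM : Summable M) {s : Set β} (hf : ∀ n, ∀ p ∈ s, |f n p| ≤ M n) :
    (∀ p ∈ s, Summable fun n => |f n p|) ∧
      TendstoUniformlyOn (fun N p => ∑ n ∈ Finset.range N, f n p) (fun p => ∑' n, f n p) atTop s :=
  ⟨fun p hp => hM.of_nonneg_of_le (fun _ => abs_nonneg _) fun n => hf n p hp,
    tendstoUniformlyOn_tsum_nat hM hf⟩

/-- The growth of the delay sine coefficients and of two derivatives is absorbed by the decay of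
the sequence `P`. -/
theorem summable_coefficient_bound {P : ℕ → ℝ} {m : ℕ} {α : ℝ} (hα : 0 < α)
    (hP : Tendsto (fun n : ℕ => P n * (n : ℝ) ^ (2 * (m : ℝ) + 3 + α)) atTop (𝓝 0))
    (hP0 : ∀ n, 0 ≤ P n) {A B C : ℝ} (hA : 0 ≤ A) (hB : 0 ≤ B) (hC : 0 ≤ C) :
    Summable fun n : ℕ =>
      C * (A * ((n + 1 : ℕ) : ℝ) ^ 2) ^ m * P (n + 1) * (1 + B * ((n + 1 : ℕ) : ℝ)) ^ 2 := by
  obtain ⟨D, hD⟩ := hP.bddAbove_range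
  have hs : Summable fun n : ℕ =>
      C * A ^ m * (1 + B) ^ 2 * D * (1 / ((n + 1 : ℕ) : ℝ) ^ (1 + α)) :=
    ((summable_nat_add_iff 1).2 (Real.summable_one_div_nat_rpow.2 (by linarith))).mul_left _
  refine hs.of_nonneg_of_le (fun n => ?_) fun n => ?_
  · have := hP0 (n + 1)
    positivity
  · have hPD := hD (mem_range_self (n + 1))
    beta_reduce at hPD
    have hP1 := hP0 (n + 1)
    set x : ℝ := ((n + 1 : ℕ) : ℝ) with hx
    have hx1 : 1 ≤ x := by simp [hx]
    have hx0 : 0 < x := by linarith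
    have hxp : x ^ (2 * (m : ℝ) + 3 + α) = (x ^ 2) ^ m * x ^ 2 * x ^ (1 + α) := by
      rw [← pow_mul, ← pow_add, ← Real.rpow_natCast, ← Real.rpow_add hx0]
      congr 1
      push_cast
      ring
    have hBx : (1 + B * x) ^ 2 ≤ (1 + B) ^ 2 * x ^ 2 := by
      rw [← mul_pow]
      gcongr
      nlinarith
    rw [hxp] at hPD
    rw [mul_one_div, le_div_iff₀ (by positivity), mul_pow]
    calc C * (A ^ m * (x ^ 2) ^ m) * P (n + 1) * (1 + B * x) ^ 2 * x ^ (1 + α)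
        ≤ C * (A ^ m * (x ^ 2) ^ m) * P (n + 1) * ((1 + B) ^ 2 * x ^ 2) * x ^ (1 + α) := by gcongr
      _ = C * A ^ m * (1 + B) ^ 2 * (P (n + 1) * ((x ^ 2) ^ m * x ^ 2 * x ^ (1 + α))) := by ring
      _ ≤ C * A ^ m * (1 + B) ^ 2 * D := by gcongr

/-- **Convergence of the second Fourier series `S₂`** in the solution of the delay wave
equation: with `ω_n = √((πna/l)² - c)` (where `c < (πa/l)²`), `m = ⌈T/τ⌉` and continuous
functions `ψ_n` on `[-τ,0]` satisfying `(max_{[-τ,0]} |ψ_n|) n^(2m+3+α) → 0` for some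
`α > 0`, the series
`S₂(t,x) = ∑_{n≥1} ((1/ω_n) ∫_{-τ}^0 sin_τ(ω_n, t-τ-s) ψ_n(s) ds) sin(πnx/l)` converges
absolutely and uniformly on `[0,T] × [0,l]`; the term-wise partial-derivative series of
total order `≤ 2` converge absolutely and uniformly on compact subsets of `(0,T) × [0,l]`;
`S₂` is twice continuously differentiable on `(0,T) × (0,l)` and its partial derivatives of
order `≤ 2` are obtained by term-wise differentiation. -/
theorem delay_wave_series_S2 (l a τ T c α : ℝ)
    (hl : 0 < l) (ha : 0 < a) (hτ : 0 < τ) (hT : 0 < T)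
    (hc : c < (π * a / l) ^ 2) (hα : 0 < α)
    (dsin : ℝ → ℝ → ℝ)
    (hdsin : ∀ ω : ℝ, 0 < ω → IsDelaySin τ ω (dsin ω))
    (ψ : ℕ → ℝ → ℝ)
    (hψ : ∀ n : ℕ, ContinuousOn (ψ n) (Set.Icc (-τ) 0))
    (hdecay : Filter.Tendsto
      (fun n : ℕ =>
        sSup ((fun s => |ψ n s|) '' Set.Icc (-τ) 0) *
          (n : ℝ) ^ (2 * ((⌈T / τ⌉₊ : ℕ) : ℝ) + 3 + α))
      Filter.atTop (nhds 0)) :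
    let ω : ℕ → ℝ := fun n => Real.sqrt ((π * n * a / l) ^ 2 - c)
    let u : ℕ → ℝ → ℝ → ℝ := fun n t x =>
      (1 / ω n * ∫ s in (-τ)..(0 : ℝ), dsin (ω n) (t - τ - s) * ψ n s) *
        Real.sin (π * n * x / l)
    let S : ℝ → ℝ → ℝ := fun t x => ∑' n : ℕ, u (n + 1) t x
    (∀ t ∈ Set.Icc (0 : ℝ) T, ∀ x ∈ Set.Icc (0 : ℝ) l,
      Summable (fun n : ℕ => |u (n + 1) t x|)) ∧
    TendstoUniformlyOn
      (fun N (pt : ℝ × ℝ) => ∑ n ∈ Finset.range N, u (n + 1) pt.1 pt.2)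
      (fun pt => S pt.1 pt.2) Filter.atTop (Set.Icc 0 T ×ˢ Set.Icc 0 l) ∧
    (∀ i j : ℕ, i + j ≤ 2 →
      ∀ K : Set (ℝ × ℝ), K ⊆ Set.Ioo 0 T ×ˢ Set.Icc 0 l → IsCompact K →
        (∀ pt ∈ K, Summable (fun n : ℕ => |pd i j (u (n + 1)) pt.1 pt.2|)) ∧
        TendstoUniformlyOn
          (fun N (pt : ℝ × ℝ) => ∑ n ∈ Finset.range N, pd i j (u (n + 1)) pt.1 pt.2)
          (fun pt => ∑' n : ℕ, pd i j (u (n + 1)) pt.1 pt.2) Filter.atTop K) ∧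
    ContDiffOn ℝ 2 (fun pt : ℝ × ℝ => S pt.1 pt.2) (Set.Ioo 0 T ×ˢ Set.Ioo 0 l) ∧
    (∀ i j : ℕ, i + j ≤ 2 → ∀ t ∈ Set.Ioo (0 : ℝ) T, ∀ x ∈ Set.Ioo (0 : ℝ) l,
      pd i j S t x = ∑' n : ℕ, pd i j (u (n + 1)) t x) := by
  intro ω u S
  set m : ℕ := ⌈T / τ⌉₊
  set P : ℕ → ℝ := fun n => sSup ((fun s => |ψ n s|) '' Set.Icc (-τ) 0)
  have hP : ∀ n, ∀ s ∈ Icc (-τ) 0, |ψ n s| ≤ P n := fun n s hs =>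
    le_csSup (isCompact_Icc.image_of_continuousOn (hψ n).abs).bddAbove (mem_image_of_mem _ hs)
  have hP0 : ∀ n, 0 ≤ P n := fun n =>
    (abs_nonneg _).trans (hP n 0 ⟨by linarith, le_rfl⟩)
  have hmT : T ≤ m * τ := by
    rw [← div_le_iff₀ hτ]
    exact Nat.le_ceil _
  obtain ⟨C, hC0, hC⟩ := exists_bound_delaySin_coefficient hτ hmT
  set A : ℝ := 1 + (π * a / l) ^ 2 + |c| with hA
  set B : ℝ := π / l
  have hB0 : 0 ≤ B := by positivity
  have hA1 : 1 ≤ A := by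
    have := abs_nonneg c
    have := sq_nonneg (π * a / l)
    linarith
  have hn1 : ∀ n : ℕ, 1 ≤ ((n + 1 : ℕ) : ℝ) := fun n => by simp
  have hsq : ∀ n : ℕ,
      (π * (n + 1 : ℕ) * a / l) ^ 2 = ((n + 1 : ℕ) : ℝ) ^ 2 * (π * a / l) ^ 2 := fun n => by ring
  have hrad : ∀ n : ℕ, 0 < (π * (n + 1 : ℕ) * a / l) ^ 2 - c := by
    intro n
    have h2 := one_le_pow₀ (hn1 n) (n := 2)
    rw [hsq]
    nlinarith [sq_nonneg (π * a / l)]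
  have hω : ∀ n : ℕ, 0 < ω (n + 1) := fun n => Real.sqrt_pos.2 (hrad n)
  have hW1 : ∀ n : ℕ, 1 ≤ A * ((n + 1 : ℕ) : ℝ) ^ 2 := fun n =>
    one_le_mul_of_one_le_of_one_le hA1 (one_le_pow₀ (hn1 n))
  have hW : ∀ n : ℕ, ω (n + 1) ^ 2 ≤ A * ((n + 1 : ℕ) : ℝ) ^ 2 := by
    intro n
    rw [Real.sq_sqrt (hrad n).le]
    have h2 := one_le_pow₀ (hn1 n) (n := 2)
    rw [hsq, hA]
    nlinarith [neg_abs_le c, abs_nonneg c]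
  set g : ℕ → ℝ → ℝ := fun n t =>
    1 / ω (n + 1) * ∫ s in (-τ)..0, dsin (ω (n + 1)) (t - τ - s) * ψ (n + 1) s
  set h : ℕ → ℝ → ℝ := fun n x => Real.sin (B * (n + 1 : ℕ) * x)
  have hu : ∀ n, u (n + 1) = fun t x => g n t * h n x := by
    intro n
    ext t x
    simp only [u, g, h, B]
    congr 2
    ring
  have hcoef := fun n => hC (ω (n + 1)) _ (P (n + 1)) _ _ (hω n) (hW n) (hW1 n)
    (hdsin _ (hω n)) (hψ (n + 1)) (hP (n + 1))
  have hg2 : ∀ n, ContDiffOn ℝ (2 : ℕ) (g n) (Ioo 0 T) := fun n => (hcoef n).1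
  have hh2 : ∀ n, ContDiff ℝ (2 : ℕ) (h n) := fun n =>
    Real.contDiff_sin.comp (contDiff_const.mul contDiff_id)
  have hM := summable_coefficient_bound hα hdecay hP0 (zero_le_one.trans hA1) hB0 hC0
  have hsin : ∀ n q, q ≤ 2 → ∀ x, |iteratedDeriv q (h n) x| ≤ (1 + B * (n + 1 : ℕ)) ^ 2 :=
    fun n q hq x => abs_iteratedDeriv_sin_const_mul_le (by positivity) hq x
  have hb : ∀ i q, i + q ≤ 2 → ∀ n, ∀ t ∈ Ioo 0 T, ∀ x,
      |iteratedDeriv i (g n) t * iteratedDeriv q (h n) x| ≤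
        C * (A * ((n + 1 : ℕ) : ℝ) ^ 2) ^ m * P (n + 1) * (1 + B * ((n + 1 : ℕ) : ℝ)) ^ 2 := by
    intro i q hiq n t ht x
    rw [abs_mul]
    have h1 := (hcoef n).2.1 i (by omega) t ht
    exact mul_le_mul h1 (hsin n q (by omega) x) (abs_nonneg _) ((abs_nonneg _).trans h1)
  have hb0 : ∀ n, ∀ p ∈ Icc 0 T ×ˢ Icc 0 l, |u (n + 1) p.1 p.2| ≤
      C * (A * ((n + 1 : ℕ) : ℝ) ^ 2) ^ m * P (n + 1) * (1 + B * ((n + 1 : ℕ) : ℝ)) ^ 2 := by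
    intro n p hp
    rw [hu, abs_mul]
    have h1 := (hcoef n).2.2 p.1 hp.1
    have h2 := hsin n 0 (by norm_num) p.2
    rw [iteratedDeriv_zero] at h2
    exact mul_le_mul h1 h2 (abs_nonneg _) ((abs_nonneg _).trans h1)
  have hclosed := summable_abs_and_tendstoUniformlyOn hM hb0
  refine ⟨fun t ht x hx => hclosed.1 (t, x) ⟨ht, hx⟩, hclosed.2, fun i j hij K hK _ => ?_, ?_, ?_⟩
  · refine summable_abs_and_tendstoUniformlyOn hM fun n p hp => ?_
    rw [hu, pd_mul]
    exact hb i j hij n p.1 (hK hp).1 p.2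
  · simp only [S, hu]
    exact (contDiffOn_tsum_mul isOpen_Ioo isPreconnected_Ioo hg2 hh2 hM hb).mono
      (prod_mono_right (subset_univ _))
  · intro i j hij t ht x _
    simp only [S, hu]
    exact pd_tsum_mul isOpen_Ioo isPreconnected_Ioo hg2 hh2 hM hb hij ht x
end
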